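/- (A priori global spacetime bound, defocusing case, n ≥ 2.) For every dimension n ≥ 2 there exists a constant C = C(n) > 0 such that every solution u as in the setup with λ > 0 satisfies ( ∫_ℝ ∫_{ℝⁿ} |ξ|^{-(n-3)} |𝓕(|u(t,·)|²)(ξ)|² dξ dt )^{1/2} ≤ C ‖u₀‖^{3/2}_{L²(ℝⁿ)} ( sup_{t∈ℝ} ‖∇u(t,·)‖_{L²(ℝⁿ)} )^{1/2}. (The left-hand side is the L²_{t,x} norm of D^{-(n-3)/2}(|u|²), where D^α is the Fourier multiplier with symbol |ξ|^α.) -/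

import Mathlib

open MeasureTheory Complex
open scoped FourierTransform

noncomputable section

/-- Euclidean space `ℝⁿ`. -/
abbrev En (n : ℕ) := EuclideanSpace ℝ (Fin n)

/-- Partial derivative `∂_{x_j} f` of a complex-valued function. -/
noncomputable def pd {n : ℕ} (j : Fin n) (f : En n → ℂ) (x : En n) : ℂ :=
  fderiv ℝ f x (EuclideanSpace.single j 1)

/-- Laplacian `Δf` of a complex-valued function. -/
noncomputable def lap {n : ℕ} (f : En n → ℂ) (x : En n) : ℂ := ∑ j, pd j (pd j f) x

/-- Partial derivative `∂_{x_j} f` of a real-valued function. -/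
noncomputable def rpd {n : ℕ} (j : Fin n) (f : En n → ℝ) (x : En n) : ℝ :=
  fderiv ℝ f x (EuclideanSpace.single j 1)

/-- Laplacian `Δf` of a real-valued function. -/
noncomputable def rlap {n : ℕ} (f : En n → ℝ) (x : En n) : ℝ := ∑ j, rpd j (rpd j f) x

/-- `u : ℝ × ℝⁿ → ℂ` is a smooth solution of the NLS `i∂ₜu + Δu = λ|u|^{p-1}u`,
Schwartz class in `x` locally uniformly in `t`. -/
structure NLSSolution (n : ℕ) (p lam : ℝ) (u : ℝ → En n → ℂ) : Prop where
  smooth : ContDiff ℝ (⊤ : ℕ∞) (fun q : ℝ × En n => u q.1 q.2)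
  decay : ∀ (k N : ℕ) (T : ℝ), ∃ C : ℝ, ∀ t : ℝ, |t| ≤ T → ∀ x : En n,
      ‖x‖ ^ N * ‖iteratedFDeriv ℝ k (u t) x‖ ≤ C
  eq : ∀ (t : ℝ) (x : En n),
      Complex.I * deriv (fun s => u s x) t + lap (u t) x
        = (lam : ℂ) * ((‖u t x‖ ^ (p - 1) : ℝ) : ℂ) * u t x

/-- The momentum density `p_j = Im(ū ∂_{x_j} u)`. -/
noncomputable def mom {n : ℕ} (u : ℝ → En n → ℂ) (j : Fin n) (t : ℝ) (x : En n) : ℝ :=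
  (starRingEnd ℂ (u t x) * pd j (u t) x).im

/-- The Morawetz action centered at `y`:
`M_y(t) = ∫ ((x-y)/|x-y|) · Im(ū ∇u)(t,x) dx`. -/
noncomputable def morAction {n : ℕ} (u : ℝ → En n → ℂ) (y : En n) (t : ℝ) : ℝ :=
  ∫ x : En n, ∑ j, ((x j - y j) / ‖x - y‖) * mom u j t x

/-- Jointly continuous, rapidly decaying in `x` locally uniformly in `t`. -/
def Good {E V : Type*} [NormedAddCommGroup E] [NormedAddCommGroup V] (f : ℝ → E → V) : Prop :=
  Continuous (fun q : ℝ × E => f q.1 q.2) ∧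
    ∀ (N : ℕ) (T : ℝ), ∃ C : ℝ, ∀ t : ℝ, |t| ≤ T → ∀ x : E, (1 + ‖x‖) ^ N * ‖f t x‖ ≤ C

section goodsec
variable {E V W : Type*} [NormedAddCommGroup E] [NormedAddCommGroup V] [NormedAddCommGroup W]

lemma Good.of_bound {f : ℝ → E → V} {g : ℝ → E → W} (hf : Good f)
    (hg : Continuous (fun q : ℝ × E => g q.1 q.2))
    (h : ∀ T : ℝ, ∃ K : ℝ, ∀ t : ℝ, |t| ≤ T → ∀ x, ‖g t x‖ ≤ K * ‖f t x‖) : Good g := by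
  refine ⟨hg, fun N T => ?_⟩
  obtain ⟨C, hC⟩ := hf.2 N T
  obtain ⟨K, hK⟩ := h T
  refine ⟨|K| * C, fun t ht x => ?_⟩
  have h1 := hC t ht x
  have h2 := hK t ht x
  calc (1 + ‖x‖) ^ N * ‖g t x‖ ≤ (1 + ‖x‖) ^ N * (|K| * ‖f t x‖) := by
        gcongr
        exact h2.trans (by gcongr; exact le_abs_self K)
    _ = |K| * ((1 + ‖x‖) ^ N * ‖f t x‖) := by ring
    _ ≤ |K| * C := by gcongr

lemma Good.of_le {f : ℝ → E → V} {g : ℝ → E → W} (hf : Good f)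
    (hg : Continuous (fun q : ℝ × E => g q.1 q.2))
    (h : ∀ t x, ‖g t x‖ ≤ ‖f t x‖) : Good g :=
  hf.of_bound hg fun T => ⟨1, fun t _ x => by simpa using h t x⟩

lemma Good.bdd {f : ℝ → E → V} (hf : Good f) (T : ℝ) :
    ∃ C : ℝ, 0 ≤ C ∧ ∀ t : ℝ, |t| ≤ T → ∀ x, ‖f t x‖ ≤ C := by
  obtain ⟨C, hC⟩ := hf.2 0 T
  exact ⟨|C|, abs_nonneg _, fun t ht x => by simpa using (hC t ht x).trans (le_abs_self C)⟩

lemma Good.cont {f : ℝ → E → V} (hf : Good f) (t : ℝ) : Continuous (f t) :=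
  hf.1.comp (by fun_prop : Continuous fun x : E => (t, x))

lemma Good.add {f g : ℝ → E → V} (hf : Good f) (hg : Good g) :
    Good (fun t x => f t x + g t x) := by
  refine ⟨hf.1.add hg.1, fun N T => ?_⟩
  obtain ⟨C, hC⟩ := hf.2 N T
  obtain ⟨D, hD⟩ := hg.2 N T
  refine ⟨C + D, fun t ht x => ?_⟩
  calc (1 + ‖x‖) ^ N * ‖f t x + g t x‖ ≤ (1 + ‖x‖) ^ N * (‖f t x‖ + ‖g t x‖) := by
        gcongr; exact norm_add_le _ _
    _ ≤ C + D := by rw [mul_add]; exact add_le_add (hC t ht x) (hD t ht x)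

lemma Good.neg {f : ℝ → E → V} (hf : Good f) : Good (fun t x => - f t x) :=
  hf.of_le hf.1.neg (by simp)

lemma Good.sub {f g : ℝ → E → V} (hf : Good f) (hg : Good g) :
    Good (fun t x => f t x - g t x) := by
  simpa [sub_eq_add_neg] using hf.add hg.neg

lemma Good.zero : Good (fun (_ : ℝ) (_ : E) => (0 : V)) :=
  ⟨continuous_const, fun _ _ => ⟨0, by simp⟩⟩

lemma Good.sum {ι : Type*} (s : Finset ι) {f : ι → ℝ → E → V} (hf : ∀ i, Good (f i)) :
    Good (fun t x => ∑ i ∈ s, f i t x) := by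
  classical
  induction s using Finset.induction_on with
  | empty => simpa using Good.zero
  | insert a s ha ih => simpa [Finset.sum_insert ha] using (hf a).add ih

lemma Good.mul {R : Type*} [NormedRing R] {f g : ℝ → E → R} (hf : Good f) (hg : Good g) :
    Good (fun t x => f t x * g t x) := by
  refine hg.of_bound (hf.1.mul hg.1) fun T => ?_
  obtain ⟨C, -, hC⟩ := hf.bdd T
  exact ⟨C, fun t ht x => (norm_mul_le _ _).trans (by gcongr; exact hC t ht x)⟩

lemma Good.const_mul {R : Type*} [NormedRing R] {f : ℝ → E → R} (c : R) (hf : Good f) :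
    Good (fun t x => c * f t x) :=
  hf.of_bound (continuous_const.mul hf.1) fun _ => ⟨‖c‖, fun _ _ _ => norm_mul_le _ _⟩

lemma Good.conj {f : ℝ → E → ℂ} (hf : Good f) : Good (fun t x => starRingEnd ℂ (f t x)) :=
  hf.of_le (Complex.continuous_conj.comp hf.1) (by simp)

lemma Good.re {f : ℝ → E → ℂ} (hf : Good f) : Good (fun t x => (f t x).re) :=
  hf.of_le (Complex.continuous_re.comp hf.1) (fun _ _ => Complex.abs_re_le_norm _)

lemma Good.im {f : ℝ → E → ℂ} (hf : Good f) : Good (fun t x => (f t x).im) :=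
  hf.of_le (Complex.continuous_im.comp hf.1) (fun _ _ => Complex.abs_im_le_norm _)

lemma Good.normSq {f : ℝ → E → ℂ} (hf : Good f) : Good (fun t x => ‖f t x‖ ^ 2) := by
  refine hf.of_bound (hf.1.norm.pow 2) fun T => ?_
  obtain ⟨C, -, hC⟩ := hf.bdd T
  refine ⟨C, fun t ht x => ?_⟩
  rw [norm_pow, norm_norm, sq]
  gcongr
  exact hC t ht x

lemma Good.rpow {f : ℝ → E → ℂ} (hf : Good f) {r : ℝ} (hr : 1 < r) :
    Good (fun t x => ‖f t x‖ ^ r) := by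
  refine hf.of_bound (hf.1.norm.rpow_const fun _ => Or.inr (by linarith)) fun T => ?_
  obtain ⟨C, hC0, hC⟩ := hf.bdd T
  refine ⟨C ^ (r - 1), fun t ht x => ?_⟩
  rw [Real.norm_of_nonneg (by positivity)]
  have : ‖f t x‖ ^ r = ‖f t x‖ ^ (r - 1) * ‖f t x‖ := by
    rw [← Real.rpow_add_one' (norm_nonneg _) (by linarith)]; ring_nf
  rw [this]
  gcongr
  exact hC t ht x

variable [NormedSpace ℝ E] [FiniteDimensional ℝ E] [MeasurableSpace E] [BorelSpace E]
  {μ : Measure E} [μ.IsAddHaarMeasure]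

lemma Good.dom {f : ℝ → E → V} (hf : Good f) (T : ℝ) :
    ∃ b : E → ℝ, Integrable b μ ∧ ∀ t : ℝ, |t| ≤ T → ∀ x, ‖f t x‖ ≤ b x := by
  set N := Module.finrank ℝ E + 1
  obtain ⟨C, hC⟩ := hf.2 N T
  refine ⟨fun x => C * (1 + ‖x‖) ^ (-(N : ℝ)), ?_, fun t ht x => ?_⟩
  · exact (integrable_one_add_norm (by simp [N])).const_mul _
  · have h := hC t ht x
    have h1 : 0 < (1 + ‖x‖) ^ N := by positivity
    show ‖f t x‖ ≤ C * (1 + ‖x‖) ^ (-(N : ℝ))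
    rw [Real.rpow_neg (by positivity), Real.rpow_natCast, ← div_eq_mul_inv, le_div_iff₀ h1]
    linarith

lemma Good.integrable {f : ℝ → E → V} (hf : Good f) (t : ℝ) : Integrable (f t) μ := by
  obtain ⟨b, hb, h⟩ := hf.dom (μ := μ) |t|
  exact hb.mono' (hf.cont t).aestronglyMeasurable (.of_forall (h t le_rfl))

lemma Good.hasDerivAt_integral [NormedSpace ℝ V] {f f' : ℝ → E → V} (hf : Good f)
    (hf' : Good f') (h : ∀ t x, HasDerivAt (fun s => f s x) (f' t x) t) (t : ℝ) :
    HasDerivAt (fun s => ∫ x, f s x ∂μ) (∫ x, f' t x ∂μ) t := by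
  obtain ⟨b, hb, hbd⟩ := hf'.dom (μ := μ) (|t| + 1)
  refine (hasDerivAt_integral_of_dominated_loc_of_deriv_le (s := Metric.ball t 1)
    (Metric.ball_mem_nhds t one_pos)
    (.of_forall fun s => (hf.cont s).aestronglyMeasurable) (hf.integrable t)
    (hf'.cont t).aestronglyMeasurable (.of_forall fun x s hs => hbd s ?_ x) hb
    (.of_forall fun x s _ => h s x)).2
  have : |s - t| < 1 := by simpa [Real.dist_eq] using hs
  have := abs_sub_abs_le_abs_sub s t
  linarith

end goodsec

lemma Good.tensor {E : Type*} [NormedAddCommGroup E] {f g : ℝ → E → ℝ} (hf : Good f) (hg : Good g)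
    {h : E × E → ℝ} (hh : Continuous h) {B : ℝ} (hB : ∀ z, |h z| ≤ B) :
    Good (fun t (z : E × E) => h z * (f t z.1 * g t z.2)) := by
  refine ⟨?_, fun N T => ?_⟩
  · have h1 : Continuous fun q : ℝ × E × E => f q.1 q.2.1 :=
      hf.1.comp (by fun_prop : Continuous fun q : ℝ × E × E => (q.1, q.2.1))
    have h2 : Continuous fun q : ℝ × E × E => g q.1 q.2.2 :=
      hg.1.comp (by fun_prop : Continuous fun q : ℝ × E × E => (q.1, q.2.2))
    exact (hh.comp continuous_snd).mul (h1.mul h2)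
  · obtain ⟨C, hC⟩ := hf.2 N T
    obtain ⟨D, hD⟩ := hg.2 N T
    refine ⟨B * (C * D), fun t ht z => ?_⟩
    have hB0 : 0 ≤ B := (abs_nonneg _).trans (hB z)
    have hz : 1 + ‖z‖ ≤ (1 + ‖z.1‖) * (1 + ‖z.2‖) := by
      have : ‖z‖ ≤ ‖z.1‖ + ‖z.2‖ := by
        rw [Prod.norm_def]; exact max_le_add_of_nonneg (norm_nonneg _) (norm_nonneg _)
      nlinarith [norm_nonneg z.1, norm_nonneg z.2]
    have h1 := hC t ht z.1
    have h2 := hD t ht z.2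
    have hC0 : 0 ≤ C := le_trans (by positivity) h1
    calc (1 + ‖z‖) ^ N * ‖h z * (f t z.1 * g t z.2)‖
        = |h z| * ((1 + ‖z‖) ^ N * (‖f t z.1‖ * ‖g t z.2‖)) := by
          rw [norm_mul, norm_mul, Real.norm_eq_abs (h z)]; ring
      _ ≤ B * (((1 + ‖z.1‖) * (1 + ‖z.2‖)) ^ N * (‖f t z.1‖ * ‖g t z.2‖)) := by
          gcongr
          exact hB z
      _ = B * (((1 + ‖z.1‖) ^ N * ‖f t z.1‖) * ((1 + ‖z.2‖) ^ N * ‖g t z.2‖)) := by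
          rw [mul_pow]; ring
      _ ≤ B * (C * D) := by gcongr

/-- Directional space derivative. -/
def Dx {n : ℕ} (v : En n) (f : ℝ → En n → ℂ) : ℝ → En n → ℂ := fun t x => fderiv ℝ (f t) x v

/-- Time derivative. -/
def Dt {n : ℕ} (f : ℝ → En n → ℂ) : ℝ → En n → ℂ := fun t x => deriv (fun s => f s x) t

/-- Joint smoothness. -/
def SmoothT {n : ℕ} (f : ℝ → En n → ℂ) : Prop :=
  ContDiff ℝ (⊤ : ℕ∞) (fun q : ℝ × En n => f q.1 q.2)

/-- Schwartz decay locally uniformly in time. -/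
def Rap {n : ℕ} (f : ℝ → En n → ℂ) : Prop :=
  ∀ (k N : ℕ) (T : ℝ), ∃ C : ℝ, ∀ t : ℝ, |t| ≤ T → ∀ x : En n,
      ‖x‖ ^ N * ‖iteratedFDeriv ℝ k (f t) x‖ ≤ C

section smoothsec
variable {n : ℕ} {f : ℝ → En n → ℂ}

lemma SmoothT.hasFDerivAt (hf : SmoothT f) (q : ℝ × En n) :
    HasFDerivAt (fun q : ℝ × En n => f q.1 q.2) (fderiv ℝ (fun q : ℝ × En n => f q.1 q.2) q) q :=
  (ContDiff.differentiable hf (by simp) q).hasFDerivAt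

lemma SmoothT.slice (hf : SmoothT f) (t : ℝ) : ContDiff ℝ (⊤ : ℕ∞) (f t) :=
  ContDiff.comp (g := fun q : ℝ × En n => f q.1 q.2) hf
    (by fun_prop : ContDiff ℝ (⊤ : ℕ∞) fun x : En n => (t, x))

lemma SmoothT.hasFDerivAt_x (hf : SmoothT f) (t : ℝ) (x : En n) :
    HasFDerivAt (f t) (fderiv ℝ (f t) x) x :=
  ((hf.slice t).differentiable (by simp) x).hasFDerivAt

lemma SmoothT.Dx_eq (hf : SmoothT f) (v : En n) (t : ℝ) (x : En n) :
    Dx v f t x = fderiv ℝ (fun q : ℝ × En n => f q.1 q.2) (t, x) (0, v) := by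
  have h : HasFDerivAt (fun x : En n => ((t, x) : ℝ × En n)) (ContinuousLinearMap.inr ℝ ℝ (En n)) x :=
    hasFDerivAt_prodMk_right t x
  have := ((hf.hasFDerivAt (t, x)).comp x h).fderiv
  have h2 : fderiv ℝ (f t) x = _ := this
  unfold Dx
  rw [h2]; simp

lemma SmoothT.Dt_hasDerivAt' (hf : SmoothT f) (t : ℝ) (x : En n) :
    HasDerivAt (fun s => f s x) (fderiv ℝ (fun q : ℝ × En n => f q.1 q.2) (t, x) (1, 0)) t := by
  have h : HasFDerivAt (fun s : ℝ => ((s, x) : ℝ × En n)) (ContinuousLinearMap.inl ℝ ℝ (En n)) t :=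
    hasFDerivAt_prodMk_left t x
  have := ((hf.hasFDerivAt (t, x)).comp t h).hasDerivAt
  rw [ContinuousLinearMap.comp_apply, ContinuousLinearMap.inl_apply] at this
  exact this

lemma SmoothT.Dt_eq (hf : SmoothT f) (t : ℝ) (x : En n) :
    Dt f t x = fderiv ℝ (fun q : ℝ × En n => f q.1 q.2) (t, x) (1, 0) :=
  (hf.Dt_hasDerivAt' t x).deriv

lemma SmoothT.hasDerivAt (hf : SmoothT f) (t : ℝ) (x : En n) :
    HasDerivAt (fun s => f s x) (Dt f t x) t := by
  rw [hf.Dt_eq]; exact hf.Dt_hasDerivAt' t x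

lemma SmoothT.line (hf : SmoothT f) (v : En n) (t : ℝ) (x : En n) :
    HasLineDerivAt ℝ (f t) (Dx v f t x) x v :=
  (hf.hasFDerivAt_x t x).hasLineDerivAt v

lemma SmoothT.fd (hf : SmoothT f) (w : ℝ × En n) :
    ContDiff ℝ (⊤ : ℕ∞) (fun q => fderiv ℝ (fun q : ℝ × En n => f q.1 q.2) q w) :=
  (ContDiff.fderiv_right (m := (⊤ : ℕ∞)) hf (by simp)).clm_apply contDiff_const

lemma SmoothT.Dx (hf : SmoothT f) (v : En n) : SmoothT (Dx v f) := by
  have := hf.fd (0, v)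
  unfold SmoothT
  convert this using 2 with q
  exact hf.Dx_eq v q.1 q.2

lemma SmoothT.Dt (hf : SmoothT f) : SmoothT (Dt f) := by
  have := hf.fd (1, 0)
  unfold SmoothT
  convert this using 2 with q
  exact hf.Dt_eq q.1 q.2

lemma fd_comm {E F : Type*} [NormedAddCommGroup E] [NormedSpace ℝ E] [NormedAddCommGroup F]
    [NormedSpace ℝ F] {U : E → F} (hU : ContDiff ℝ (⊤ : ℕ∞) U)
    (v w q : E) : fderiv ℝ (fun q => fderiv ℝ U q v) q w = fderiv ℝ (fun q => fderiv ℝ U q w) q v := by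
  have hd : DifferentiableAt ℝ (fderiv ℝ U) q :=
    (ContDiff.fderiv_right (m := (⊤ : ℕ∞)) hU (by simp)).differentiable (by simp) q
  have hs : IsSymmSndFDerivAt ℝ U q := by
    refine (hU.contDiffAt).isSymmSndFDerivAt ?_
    simp only [minSmoothness_of_isRCLikeNormedField]
    exact WithTop.coe_le_coe.2 (le_top : (2 : ℕ∞) ≤ ⊤)
  rw [fderiv_clm_apply hd (by fun_prop), fderiv_clm_apply hd (by fun_prop)]
  simpa using hs w v

lemma SmoothT.Dx_comm (hf : SmoothT f) (v w : En n) : _root_.Dx v (_root_.Dx w f) = _root_.Dx w (_root_.Dx v f) := by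
  funext t x
  rw [(hf.Dx w).Dx_eq, (hf.Dx v).Dx_eq]
  simp_rw [hf.Dx_eq]
  exact fd_comm hf _ _ _

lemma SmoothT.Dt_Dx (hf : SmoothT f) (v : En n) : _root_.Dt (_root_.Dx v f) = _root_.Dx v (_root_.Dt f) := by
  funext t x
  rw [(hf.Dx v).Dt_eq, (hf.Dt).Dx_eq]
  simp_rw [hf.Dx_eq, hf.Dt_eq]
  exact fd_comm hf _ _ _

lemma Rap.Dx (hs : SmoothT f) (hf : Rap f) (v : En n) : Rap (Dx v f) := by
  intro k N T
  obtain ⟨C, hC⟩ := hf (k + 1) N T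
  refine ⟨‖v‖ * C, fun t ht x => ?_⟩
  have h := hC t ht x
  have h1 : ‖iteratedFDeriv ℝ k (_root_.Dx v f t) x‖ ≤ ‖v‖ * ‖iteratedFDeriv ℝ k (fderiv ℝ (f t)) x‖ :=
    norm_iteratedFDeriv_clm_apply_const
      ((ContDiff.fderiv_right (m := (⊤ : ℕ∞)) (hs.slice t) (by simp)).contDiffAt)
      (by exact_mod_cast le_top)
  rw [norm_iteratedFDeriv_fderiv] at h1
  calc ‖x‖ ^ N * ‖iteratedFDeriv ℝ k (_root_.Dx v f t) x‖
      ≤ ‖x‖ ^ N * (‖v‖ * ‖iteratedFDeriv ℝ (k + 1) (f t) x‖) := by gcongr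
    _ = ‖v‖ * (‖x‖ ^ N * ‖iteratedFDeriv ℝ (k + 1) (f t) x‖) := by ring
    _ ≤ ‖v‖ * C := by gcongr

lemma Rap.good (hs : SmoothT f) (hf : Rap f) : Good f := by
  refine ⟨ContDiff.continuous hs, fun N T => ?_⟩
  obtain ⟨C, hC⟩ := hf 0 N T
  obtain ⟨D, hD⟩ := hf 0 0 T
  refine ⟨2 ^ N * (C + D), fun t ht x => ?_⟩
  have h1 := hC t ht x
  have h2 := hD t ht x
  rw [norm_iteratedFDeriv_zero] at h1 h2
  simp only [pow_zero, one_mul] at h2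
  have h3 : (1 + ‖x‖) ^ N ≤ 2 ^ N * (‖x‖ ^ N + 1) := by
    rcases le_total ‖x‖ 1 with h | h
    · calc (1 + ‖x‖) ^ N ≤ 2 ^ N := by gcongr; linarith
        _ ≤ 2 ^ N * (‖x‖ ^ N + 1) := by
          have : (0:ℝ) ≤ 2 ^ N * ‖x‖ ^ N := by positivity
          linarith
    · calc (1 + ‖x‖) ^ N ≤ (2 * ‖x‖) ^ N := by gcongr; linarith
        _ ≤ 2 ^ N * (‖x‖ ^ N + 1) := by
          rw [mul_pow]
          have : (0:ℝ) ≤ 2 ^ N := by positivity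
          linarith
  calc (1 + ‖x‖) ^ N * ‖f t x‖ ≤ 2 ^ N * (‖x‖ ^ N + 1) * ‖f t x‖ := by gcongr
    _ = 2 ^ N * (‖x‖ ^ N * ‖f t x‖ + ‖f t x‖) := by ring
    _ ≤ 2 ^ N * (C + D) := by gcongr

end smoothsec

/-- Lipschitz bound for the power nonlinearity. -/
lemma power_lip {p R : ℝ} (hp : 1 < p) (z w : ℂ) (hz : ‖z‖ ≤ R) (hw : ‖w‖ ≤ R) :
    ‖((‖z‖ ^ (p - 1) : ℝ) : ℂ) * z - ((‖w‖ ^ (p - 1) : ℝ) : ℂ) * w‖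
      ≤ (1 + p) * R ^ (p - 1) * ‖z - w‖ := by
  wlog h : ‖w‖ ≤ ‖z‖ generalizing z w
  · rw [norm_sub_rev, norm_sub_rev z w]
    exact this w z hw hz (le_of_not_ge h)
  rcases eq_or_ne z 0 with rfl | hz0
  · have : w = 0 := by simpa using h
    simp [this]
  have ha : 0 < ‖z‖ := norm_pos_iff.2 hz0
  set a := ‖z‖ with hadef
  set b := ‖w‖ with hbdef
  have hb : 0 ≤ b := norm_nonneg _
  have hab : a - b ≤ ‖z - w‖ := norm_sub_norm_le _ _
  have hbern := one_add_mul_self_le_rpow_one_add (s := b / a - 1)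
    (by have : 0 ≤ b / a := by positivity
        linarith) hp.le
  have hap : a ^ p = a ^ (p - 1) * a := by
    rw [← Real.rpow_add_one' ha.le (by linarith)]; ring_nf
  have hbp : b ^ p = b ^ (p - 1) * b := by
    rw [← Real.rpow_add_one' hb (by linarith)]; ring_nf
  have h1 : a ^ p - b ^ p ≤ p * a ^ (p - 1) * (a - b) := by
    rw [add_sub_cancel, Real.div_rpow hb ha.le, le_div_iff₀ (by positivity)] at hbern
    have : (1 + p * (b / a - 1)) * a ^ p = a ^ p + p * a ^ (p - 1) * (b - a) := by
      rw [hap]; field_simp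
    linarith
  have h2 : a ^ (p - 1) * b ≤ a ^ p := by
    rw [hap]; gcongr
  have h3 : b ^ (p - 1) ≤ a ^ (p - 1) := by gcongr
  have h4 : a ^ (p - 1) ≤ R ^ (p - 1) := by gcongr
  have e : ((a ^ (p - 1) : ℝ) : ℂ) * z - ((b ^ (p - 1) : ℝ) : ℂ) * w
      = ((a ^ (p - 1) : ℝ) : ℂ) * (z - w) + ((a ^ (p - 1) - b ^ (p - 1) : ℝ) : ℂ) * w := by
    push_cast; ring
  rw [e]
  refine (norm_add_le _ _).trans ?_
  rw [norm_mul, norm_mul, Complex.norm_real, Complex.norm_real, Real.norm_of_nonneg (by positivity),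
    Real.norm_of_nonneg (by linarith), ← hbdef]
  have h5 : (a ^ (p - 1) - b ^ (p - 1)) * b ≤ p * a ^ (p - 1) * ‖z - w‖ := by
    calc (a ^ (p - 1) - b ^ (p - 1)) * b ≤ p * a ^ (p - 1) * (a - b) := by
          rw [sub_mul, ← hbp]; linarith
      _ ≤ _ := by gcongr
  calc _ ≤ (1 + p) * a ^ (p - 1) * ‖z - w‖ := by linarith
    _ ≤ _ := by gcongr

lemma deriv_lip {φ ψ : ℝ → ℂ} {φ' ψ' : ℂ} {K : ℝ} (hφ : HasDerivAt φ φ' 0)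
    (hψ : HasDerivAt ψ ψ' 0) (h : ∀ s, ‖φ s - φ 0‖ ≤ K * ‖ψ s - ψ 0‖) : ‖φ'‖ ≤ K * ‖ψ'‖ := by
  have h1 := (hasDerivAt_iff_tendsto_slope.1 hφ).norm
  have h2 := ((hasDerivAt_iff_tendsto_slope.1 hψ).norm).const_mul K
  refine le_of_tendsto_of_tendsto' h1 h2 fun s => ?_
  simp only [slope_def_module, norm_smul]
  have := h s
  calc _ ≤ ‖(s - 0)⁻¹‖ * (K * ‖ψ s - ψ 0‖) := by gcongr
    _ = _ := by ring

lemma hasDerivAt_norm_rpow_comp {γ : ℝ → ℂ} {γ' : ℂ} {s p : ℝ} (hp : 1 < p)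
    (h : HasDerivAt γ γ' s) :
    HasDerivAt (fun s => ‖γ s‖ ^ (p + 1))
      ((p + 1) * ‖γ s‖ ^ (p - 1) * (starRingEnd ℂ (γ s) * γ').re) s := by
  have := (hasFDerivAt_norm_rpow (γ s) (p := p + 1) (by linarith)).comp_hasDerivAt s h
  have e : p + 1 - 2 = p - 1 := by ring
  have e2 : (((p + 1) * ‖γ s‖ ^ (p + 1 - 2)) • (innerSL ℝ) (γ s)) γ'
      = (p + 1) * ‖γ s‖ ^ (p - 1) * (starRingEnd ℂ (γ s) * γ').re := by
    rw [e]
    simp only [Complex.inner, smul_apply, innerSL_apply_apply, smul_eq_mul]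
    rw [mul_comm γ']
  rw [e2] at this
  exact this

lemma hasDerivAt_norm_sq_comp {γ : ℝ → ℂ} {γ' : ℂ} {s : ℝ}
    (h : HasDerivAt γ γ' s) :
    HasDerivAt (fun s => ‖γ s‖ ^ 2) (2 * (starRingEnd ℂ (γ s) * γ').re) s := by
  have := h.norm_sq
  convert this using 1
  simp [Complex.inner]
  ring

lemma HasDerivAt.conj' {γ : ℝ → ℂ} {γ' : ℂ} {s : ℝ} (h : HasDerivAt γ γ' s) :
    HasDerivAt (fun s => starRingEnd ℂ (γ s)) (starRingEnd ℂ γ') s :=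
  h.star

lemma HasDerivAt.re' {γ : ℝ → ℂ} {γ' : ℂ} {s : ℝ} (h : HasDerivAt γ γ' s) :
    HasDerivAt (fun s => (γ s).re) γ'.re s := by
  exact Complex.reCLM.hasFDerivAt.comp_hasDerivAt s h

lemma HasDerivAt.im' {γ : ℝ → ℂ} {γ' : ℂ} {s : ℝ} (h : HasDerivAt γ γ' s) :
    HasDerivAt (fun s => (γ s).im) γ'.im s := by
  exact Complex.imCLM.hasFDerivAt.comp_hasDerivAt s h

/-- Standard basis vector. -/
abbrev eb {n : ℕ} (j : Fin n) : En n := EuclideanSpace.single j 1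

/-- Space-time Laplacian. -/
def Lapl {n : ℕ} (u : ℝ → En n → ℂ) : ℝ → En n → ℂ := fun t x => ∑ j, Dx (eb j) (Dx (eb j) u) t x

lemma integral_line_zero {E : Type*} [NormedAddCommGroup E] [NormedSpace ℝ E]
    [FiniteDimensional ℝ E] [MeasurableSpace E] [BorelSpace E] {μ : Measure E} [μ.IsAddHaarMeasure]
    {f f' : E → ℝ} {v : E} (hf : Integrable f μ) (hf' : Integrable f' μ)
    (h : ∀ x, HasLineDerivAt ℝ f (f' x) x v) : ∫ x, f' x ∂μ = 0 := by
  have := integral_bilinear_hasLineDerivAt_right_eq_neg_left_of_integrable (μ := μ)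
    (f := fun _ : E => (1 : ℝ)) (f' := fun _ => 0) (g := f) (g' := f') (v := v)
    (B := ContinuousLinearMap.mul ℝ ℝ) (by simp) (by simpa using hf') (by simpa using hf)
    (fun x _ => by simpa [HasLineDerivAt] using hasDerivAt_const (0 : ℝ) (1 : ℝ)) (fun x _ => h x)
  simpa using this

lemma Dx_sum {n : ℕ} (f : ℝ → En n → ℂ) (w : En n) (t : ℝ) (x : En n) :
    Dx w f t x = ∑ k, ((w k : ℝ) : ℂ) * Dx (eb k) f t x := by
  have hw : w = ∑ k, w k • (eb k : En n) := by
    ext i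
    simp [Finset.sum_apply, Pi.single_apply]
  unfold Dx
  conv_lhs => rw [hw]
  rw [map_sum]
  simp [map_smul]

section nls
variable {n : ℕ} {p lam : ℝ} {u : ℝ → En n → ℂ}

lemma NLSSolution.sm (h : NLSSolution n p lam u) : SmoothT u := h.smooth
lemma NLSSolution.rap (h : NLSSolution n p lam u) : Rap u := h.decay
lemma NLSSolution.g0 (h : NLSSolution n p lam u) : Good u := h.rap.good h.sm
lemma NLSSolution.g1 (h : NLSSolution n p lam u) (v : En n) : Good (Dx v u) :=
  (h.rap.Dx h.sm v).good (h.sm.Dx v)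
lemma NLSSolution.g2 (h : NLSSolution n p lam u) (v w : En n) : Good (Dx v (Dx w u)) :=
  ((h.rap.Dx h.sm w).Dx (h.sm.Dx w) v).good ((h.sm.Dx w).Dx v)
lemma NLSSolution.g3 (h : NLSSolution n p lam u) (v w z : En n) : Good (Dx v (Dx w (Dx z u))) :=
  (((h.rap.Dx h.sm z).Dx (h.sm.Dx z) w).Dx ((h.sm.Dx z).Dx w) v).good (((h.sm.Dx z).Dx w).Dx v)
lemma NLSSolution.gL (h : NLSSolution n p lam u) : Good (Lapl u) :=
  Good.sum _ fun j => h.g2 (eb j) (eb j)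

lemma NLSSolution.dt (h : NLSSolution n p lam u) (t : ℝ) (x : En n) :
    Dt u t x = I * (Lapl u t x - ((lam * ‖u t x‖ ^ (p - 1) : ℝ) : ℂ) * u t x) := by
  have := h.eq t x
  have e : lap (u t) x = Lapl u t x := rfl
  have e2 : deriv (fun s => u s x) t = Dt u t x := rfl
  rw [e, e2] at this
  have h3 : Lapl u t x - ((lam * ‖u t x‖ ^ (p - 1) : ℝ) : ℂ) * u t x = - (I * Dt u t x) := by
    push_cast at this ⊢
    rw [← this]; ring
  rw [h3]
  linear_combination (Dt u t x) * I_mul_I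

lemma NLSSolution.gt (h : NLSSolution n p lam u) (hp : 1 < p) : Good (Dt u) := by
  have h1 : Good (fun t x => ((lam * ‖u t x‖ ^ (p - 1) : ℝ) : ℂ) * u t x) := by
    refine h.g0.of_bound ?_ fun T => ?_
    · refine Continuous.mul (Complex.continuous_ofReal.comp (continuous_const.mul
        (h.g0.1.norm.rpow_const fun _ => Or.inr (by linarith)))) h.g0.1
    · obtain ⟨C, hC0, hC⟩ := h.g0.bdd T
      refine ⟨|lam| * C ^ (p - 1), fun t ht x => ?_⟩
      rw [norm_mul, Complex.norm_real, norm_mul, Real.norm_eq_abs lam,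
        Real.norm_of_nonneg (by positivity)]
      gcongr
      exact hC t ht x
  have h2 := (h.gL.sub h1).const_mul I
  have e : Dt u = fun t x => I * (Lapl u t x - ((lam * ‖u t x‖ ^ (p - 1) : ℝ) : ℂ) * u t x) := by
    funext t x; exact h.dt t x
  rw [e]; exact h2

lemma NLSSolution.lineL (h : NLSSolution n p lam u) (v : En n) (t : ℝ) (x : En n) :
    HasLineDerivAt ℝ (Lapl u t) (∑ j, Dx v (Dx (eb j) (Dx (eb j) u)) t x) x v := by
  unfold HasLineDerivAt Lapl
  exact HasDerivAt.fun_sum fun j _ => ((h.sm.Dx _).Dx _).line v t x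

lemma NLSSolution.gtx (h : NLSSolution n p lam u) (hp : 1 < p) (v : En n) : Good (Dx v (Dt u)) := by
  set L3 : ℝ → En n → ℂ := fun t x => ∑ j, Dx v (Dx (eb j) (Dx (eb j) u)) t x with hL3
  have hgL : Good L3 := Good.sum _ fun j => h.g3 _ _ _
  have hN : Good (fun t x => L3 t x + I * Dx v (Dt u) t x) := by
    refine (h.g1 v).of_bound ?_ fun T => ?_
    · exact hgL.1.add (continuous_const.mul (ContDiff.continuous (h.sm.Dt.Dx v)))
    · obtain ⟨C, hC0, hC⟩ := h.g0.bdd T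
      refine ⟨|lam| * ((1 + p) * C ^ (p - 1)), fun t ht x => ?_⟩
      have d1 := h.lineL v t x
      have d2 := h.sm.Dt.line v t x
      have d3 := h.sm.line v t x
      unfold HasLineDerivAt at d1 d2 d3
      refine deriv_lip (d1.add (d2.const_mul I)) d3 fun s => ?_
      have key : ∀ y, Lapl u t y + I * Dt u t y = (lam : ℂ) * (((‖u t y‖ ^ (p - 1) : ℝ) : ℂ) * u t y) := by
        intro y
        rw [h.dt t y]
        push_cast
        linear_combination (Lapl u t y - lam * (‖u t y‖ ^ (p - 1) : ℝ) * u t y) * I_mul_I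
      simp only [Pi.add_apply, key, ← mul_sub]
      rw [norm_mul, Complex.norm_real, Real.norm_eq_abs, mul_assoc]
      gcongr
      exact power_lip hp _ _ (hC t ht _) (hC t ht _)
  have := (hN.sub hgL).const_mul (-I)
  have e : Dx v (Dt u) = fun t x => -I * (L3 t x + I * Dx v (Dt u) t x - L3 t x) := by
    funext t x
    linear_combination (Dx v (Dt u) t x) * I_mul_I
  rw [e]; exact this

/-- A density whose time derivative is a divergence has constant integral. -/
lemma conserved {f f' : ℝ → En n → ℝ} {F F' : Fin n → ℝ → En n → ℝ} (hf : Good f) (hf' : Good f')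
    (hF : ∀ k, Good (F k)) (hF' : ∀ k, Good (F' k))
    (h1 : ∀ t x, HasDerivAt (fun s => f s x) (f' t x) t)
    (h2 : ∀ k t x, HasLineDerivAt ℝ (F k t) (F' k t x) x (eb k))
    (h3 : ∀ t x, f' t x = ∑ k, F' k t x) (t : ℝ) : ∫ x, f t x = ∫ x, f 0 x := by
  have hd : ∀ t, HasDerivAt (fun s => ∫ x, f s x) 0 t := by
    intro t
    have := hf.hasDerivAt_integral (μ := volume) hf' h1 t
    have e : ∫ x, f' t x = 0 := by
      simp_rw [h3]
      rw [integral_finsetSum _ fun k _ => (hF' k).integrable t]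
      exact Finset.sum_eq_zero fun k _ =>
        integral_line_zero ((hF k).integrable t) ((hF' k).integrable t) (h2 k t)
    rwa [e] at this
  exact is_const_of_deriv_eq_zero (fun t => (hd t).differentiableAt) (fun t => (hd t).deriv) t 0

lemma NLSSolution.mass (h : NLSSolution n p lam u) (hp : 1 < p) (t : ℝ) :
    ∫ x, ‖u t x‖ ^ 2 = ∫ x, ‖u 0 x‖ ^ 2 := by
  refine conserved (f := fun t x => ‖u t x‖ ^ 2)
    (f' := fun t x => 2 * (starRingEnd ℂ (u t x) * Dt u t x).re)
    (F := fun k t x => -2 * (starRingEnd ℂ (u t x) * Dx (eb k) u t x).im)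
    (F' := fun k t x => -2 * (starRingEnd ℂ (Dx (eb k) u t x) * Dx (eb k) u t x
      + starRingEnd ℂ (u t x) * Dx (eb k) (Dx (eb k) u) t x).im)
    h.g0.normSq (((h.g0.conj.mul (h.gt hp)).re).const_mul 2)
    (fun k => ((h.g0.conj.mul (h.g1 _)).im).const_mul _)
    (fun k => ((((h.g1 _).conj.mul (h.g1 _)).add (h.g0.conj.mul (h.g2 _ _))).im).const_mul _)
    (fun t x => hasDerivAt_norm_sq_comp (h.sm.hasDerivAt t x)) (fun k t x => ?_) (fun t x => ?_) t
  · have := ((((h.sm.line (eb k) t x).conj').mul ((h.sm.Dx (eb k)).line (eb k) t x)).im').const_mul (-2)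
    simpa [HasLineDerivAt] using this
  · rw [h.dt, Lapl, ← Finset.mul_sum, ← Complex.im_sum, Finset.sum_add_distrib, ← Finset.mul_sum]
    generalize (∑ j, Dx (eb j) (Dx (eb j) u) t x) = L
    have : (∑ k, (starRingEnd ℂ (Dx (eb k) u t x) * Dx (eb k) u t x)).im = 0 := by
      rw [Complex.im_sum]
      refine Finset.sum_eq_zero fun k _ => ?_
      simp; ring
    rw [add_im, this]
    simp
    ring

lemma NLSSolution.energy (h : NLSSolution n p lam u) (hp : 1 < p) (t : ℝ) :
    ∫ x, (∑ k, ‖Dx (eb k) u t x‖ ^ 2 + 2 * lam / (p + 1) * ‖u t x‖ ^ (p + 1))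
      = ∫ x, (∑ k, ‖Dx (eb k) u 0 x‖ ^ 2 + 2 * lam / (p + 1) * ‖u 0 x‖ ^ (p + 1)) := by
  have hp1 : p + 1 ≠ 0 := by linarith
  have gF' : ∀ k : Fin n, Good fun t x => 2 * (starRingEnd ℂ (Dx (eb k) (Dx (eb k) u) t x) * Dt u t x
      + starRingEnd ℂ (Dx (eb k) u t x) * Dx (eb k) (Dt u) t x).re := fun k =>
    ((((h.g2 _ _).conj.mul (h.gt hp)).add ((h.g1 _).conj.mul (h.gtx hp _))).re).const_mul _
  have key : ∀ t x, (∑ k, 2 * (starRingEnd ℂ (Dx (eb k) u t x) * Dx (eb k) (Dt u) t x).re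
      + 2 * lam / (p + 1) * ((p + 1) * ‖u t x‖ ^ (p - 1) * (starRingEnd ℂ (u t x) * Dt u t x).re))
      = ∑ k, 2 * (starRingEnd ℂ (Dx (eb k) (Dx (eb k) u) t x) * Dt u t x
      + starRingEnd ℂ (Dx (eb k) u t x) * Dx (eb k) (Dt u) t x).re := by
    intro t x
    simp_rw [add_re, mul_add, Finset.sum_add_distrib]
    rw [add_comm, add_left_inj, ← Finset.mul_sum, ← Complex.re_sum, ← Finset.sum_mul, ← map_sum]
    have e : (∑ j, Dx (eb j) (Dx (eb j) u) t x) = Lapl u t x := rfl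
    rw [e]
    have e2 : 2 * lam / (p + 1) * ((p + 1) * ‖u t x‖ ^ (p - 1) * (starRingEnd ℂ (u t x) * Dt u t x).re)
        = 2 * (lam * ‖u t x‖ ^ (p - 1)) * (starRingEnd ℂ (u t x) * Dt u t x).re := by
      field_simp
    rw [e2, h.dt]
    generalize Lapl u t x = L
    generalize lam * ‖u t x‖ ^ (p - 1) = c
    simp
    ring
  refine conserved (f := fun t x => ∑ k, ‖Dx (eb k) u t x‖ ^ 2 + 2 * lam / (p + 1) * ‖u t x‖ ^ (p + 1))
    (f' := fun t x => ∑ k, 2 * (starRingEnd ℂ (Dx (eb k) (Dx (eb k) u) t x) * Dt u t x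
      + starRingEnd ℂ (Dx (eb k) u t x) * Dx (eb k) (Dt u) t x).re)
    (F := fun k t x => 2 * (starRingEnd ℂ (Dx (eb k) u t x) * Dt u t x).re)
    (F' := fun k t x => 2 * (starRingEnd ℂ (Dx (eb k) (Dx (eb k) u) t x) * Dt u t x
      + starRingEnd ℂ (Dx (eb k) u t x) * Dx (eb k) (Dt u) t x).re)
    ((Good.sum _ fun k => (h.g1 (eb k)).normSq).add ((h.g0.rpow (by linarith)).const_mul _))
    (Good.sum _ gF')
    (fun k => (((h.g1 _).conj.mul (h.gt hp)).re).const_mul _)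
    gF' (fun t x => ?_) (fun k t x => ?_) (fun t x => rfl) t
  · rw [← key]
    refine HasDerivAt.add (HasDerivAt.fun_sum fun k _ => ?_)
      ((hasDerivAt_norm_rpow_comp hp (h.sm.hasDerivAt t x)).const_mul _)
    have := hasDerivAt_norm_sq_comp ((h.sm.Dx (eb k)).hasDerivAt t x)
    rwa [h.sm.Dt_Dx] at this
  · have := (((((h.sm.Dx (eb k)).line (eb k) t x).conj').mul (h.sm.Dt.line (eb k) t x)).re').const_mul 2
    simpa [HasLineDerivAt] using this

lemma NLSSolution.bddAbove (h : NLSSolution n p lam u) (hp : 1 < p) (hl : 0 < lam) :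
    BddAbove (Set.range fun t : ℝ => Real.sqrt (∫ x : En n, ∑ j, ‖pd j (u t) x‖ ^ 2)) := by
  refine ⟨Real.sqrt (∫ x, (∑ k, ‖Dx (eb k) u 0 x‖ ^ 2 + 2 * lam / (p + 1) * ‖u 0 x‖ ^ (p + 1))), ?_⟩
  rintro _ ⟨t, rfl⟩
  rw [← h.energy hp t]
  refine Real.sqrt_le_sqrt ?_
  have hp1 : 0 < p + 1 := by linarith
  have g1 : Good fun t x => ∑ k, ‖Dx (eb k) u t x‖ ^ 2 := Good.sum _ fun k => (h.g1 (eb k)).normSq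
  refine integral_mono (g1.integrable t)
    ((g1.add ((h.g0.rpow (r := p + 1) (by linarith)).const_mul _)).integrable t) fun x => ?_
  have : 0 ≤ 2 * lam / (p + 1) * ‖u t x‖ ^ (p + 1) := by positivity
  show ∑ k, ‖Dx (eb k) u t x‖ ^ 2 ≤ _
  linarith

end nls

/-- The bilinear form with kernel `a(ω·(x-y))`. -/
def BB {n : ℕ} (w : En n) (a : ℝ → ℝ) (f g : En n → ℝ) : ℝ :=
  ∫ z : En n × En n, a (inner ℝ w (z.1 - z.2)) * (f z.1 * g z.2)

/-- Bounded continuous kernel. -/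
def CB (a : ℝ → ℝ) : Prop := Continuous a ∧ ∃ B, ∀ s, |a s| ≤ B

instance instHaarProd {n : ℕ} : (volume : Measure (En n × En n)).IsAddHaarMeasure :=
  inferInstanceAs ((volume : Measure (En n)).prod (volume : Measure (En n))).IsAddHaarMeasure

section bb
variable {n : ℕ} {w : En n} {a a' : ℝ → ℝ} {f f' g g' : En n → ℝ}

lemma CB.comp (ha : CB a) (w : En n) :
    Continuous fun z : En n × En n => a (inner ℝ w (z.1 - z.2)) :=
  ha.1.comp (by fun_prop)

lemma BB_int (ha : CB a) (hf : Integrable f) (hg : Integrable g) :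
    Integrable (fun z : En n × En n => a (inner ℝ w (z.1 - z.2)) * (f z.1 * g z.2)) := by
  obtain ⟨B, hB⟩ := ha.2
  exact (hf.mul_prod hg).bdd_mul (c := B) (ha.comp w).aestronglyMeasurable
    (.of_forall fun z => hB _)

lemma BB_add_left (ha : CB a) (hf : Integrable f) (hf' : Integrable f') (hg : Integrable g) :
    BB w a (fun x => f x + f' x) g = BB w a f g + BB w a f' g := by
  unfold BB
  rw [← integral_add (BB_int ha hf hg) (BB_int ha hf' hg)]
  congr 1; funext z; ring

lemma BB_smul_left (c : ℝ) : BB w a (fun x => c * f x) g = c * BB w a f g := by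
  unfold BB
  rw [← integral_const_mul]
  congr 1; funext z; ring

lemma BB_smul_right (c : ℝ) : BB w a f (fun x => c * g x) = c * BB w a f g := by
  unfold BB
  rw [← integral_const_mul]
  congr 1; funext z; ring

lemma BB_sum_left {ι : Type*} (s : Finset ι) {F : ι → En n → ℝ} (ha : CB a)
    (hf : ∀ i, Integrable (F i)) (hg : Integrable g) :
    BB w a (fun x => ∑ i ∈ s, F i x) g = ∑ i ∈ s, BB w a (F i) g := by
  unfold BB
  rw [← integral_finsetSum _ fun i _ => BB_int ha (hf i) hg]
  congr 1; funext z; rw [Finset.sum_mul, Finset.mul_sum]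

lemma BB_sum_right {ι : Type*} (s : Finset ι) {F : ι → En n → ℝ} (ha : CB a)
    (hf : ∀ i, Integrable (F i)) (hg : Integrable g) :
    BB w a g (fun x => ∑ i ∈ s, F i x) = ∑ i ∈ s, BB w a g (F i) := by
  unfold BB
  rw [← integral_finsetSum _ fun i _ => BB_int ha hg (hf i)]
  congr 1; funext z; rw [Finset.mul_sum, Finset.mul_sum]

lemma BB_flip : BB w a f g = BB w (fun s => a (-s)) g f := by
  unfold BB
  have := integral_prod_swap (μ := (volume : Measure (En n))) (ν := (volume : Measure (En n)))
    (f := fun z : En n × En n => a (-inner ℝ w (z.1 - z.2)) * (g z.1 * f z.2))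
  refine Eq.trans ?_ this
  congr 1; funext z
  simp only [Prod.fst_swap, Prod.snd_swap]
  rw [← inner_neg_right, neg_sub, mul_comm (g z.2)]

lemma BB_swap (hev : ∀ s, a (-s) = a s) : BB w a f g = BB w a g f := by
  rw [BB_flip]; simp_rw [hev]

lemma BB_ibp_left (ha : CB a) (ha' : CB a') (hd : ∀ s, HasDerivAt a (a' s) s)
    (hf : Integrable f) (hf' : Integrable f') (hg : Integrable g) {v : En n}
    (h : ∀ x, HasLineDerivAt ℝ f (f' x) x v) :
    BB w a f' g = - inner ℝ w v * BB w a' f g := by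
  have i1 := BB_int (w := w) ha hf' hg
  have i2 := (BB_int (w := w) ha' hf hg).const_mul (inner ℝ w v)
  have := integral_line_zero (v := ((v, 0) : En n × En n)) (BB_int (w := w) ha hf hg) (i1.add i2) ?_
  · rw [integral_add' i1 i2, integral_const_mul] at this
    unfold BB; linarith
  · intro z
    have d1 : HasDerivAt (fun t : ℝ => a (inner ℝ w ((z.1 + t • v) - z.2)))
        (a' (inner ℝ w (z.1 - z.2)) * inner ℝ w v) 0 := by
      have e : HasDerivAt (fun t : ℝ => inner ℝ w ((z.1 + t • v) - z.2)) (inner ℝ w v) 0 := by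
        have : (fun t : ℝ => inner ℝ w ((z.1 + t • v) - z.2))
            = fun t => inner ℝ w (z.1 - z.2) + t * inner ℝ w v := by
          funext t
          rw [← real_inner_smul_right, ← inner_add_right]; congr 1; abel
        rw [this]
        simpa using ((hasDerivAt_id (0:ℝ)).mul_const (inner ℝ w v)).const_add (inner ℝ w (z.1 - z.2))
      have h0 := hd (inner ℝ w (z.1 - z.2))
      have h1 : HasDerivAt a (a' (inner ℝ w (z.1 - z.2))) (inner ℝ w ((z.1 + (0:ℝ) • v) - z.2)) := by
        simpa using h0
      exact h1.comp (0:ℝ) e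
    have d2 : HasDerivAt (fun t : ℝ => f (z.1 + t • v)) (f' z.1) 0 := h z.1
    have d3 := d1.mul (d2.mul_const (g z.2))
    unfold HasLineDerivAt
    simp only [Prod.fst_add, Prod.snd_add, Prod.smul_fst, Prod.smul_snd, smul_zero, add_zero]
    refine HasDerivAt.congr_deriv d3 ?_
    simp
    ring

lemma BB_ibp_right (ha : CB a) (ha' : CB a') (hd : ∀ s, HasDerivAt a (a' s) s)
    (hf : Integrable f) (hg : Integrable g) (hg' : Integrable g') {v : En n}
    (h : ∀ x, HasLineDerivAt ℝ g (g' x) x v) :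
    BB w a f g' = inner ℝ w v * BB w a' f g := by
  rw [BB_flip, BB_flip (f := f) (g := g)]
  have c1 : CB fun s => a (-s) := ⟨ha.1.comp continuous_neg, ha.2.imp fun B hB s => hB _⟩
  have c2 : CB fun s => (-1) * a' (-s) :=
    ⟨continuous_const.mul (ha'.1.comp continuous_neg),
      ha'.2.imp fun B hB s => by simpa using hB (-s)⟩
  have d : ∀ s, HasDerivAt (fun s => a (-s)) ((-1) * a' (-s)) s := by
    intro s
    have := (hd (-s)).comp s (hasDerivAt_neg s)
    rw [mul_comm]
    exact this
  rw [BB_ibp_left c1 c2 d hg hg' hf h]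
  have : BB w (fun s => (-1) * a' (-s)) g f = (-1) * BB w (fun s => a' (-s)) g f := by
    unfold BB
    rw [← integral_const_mul]
    congr 1; funext z; ring
  rw [this]; ring

end bb

section vir
variable {n : ℕ} {p lam : ℝ} {u : ℝ → En n → ℂ}

/-- mass density -/
def rho (u : ℝ → En n → ℂ) : ℝ → En n → ℝ := fun t x => ‖u t x‖ ^ 2
/-- momentum density in direction `v` -/
def JJ (u : ℝ → En n → ℂ) (v : En n) : ℝ → En n → ℝ :=
  fun t x => (starRingEnd ℂ (u t x) * Dx v u t x).im
/-- half of the derivative of the mass density in direction `v` -/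
def RR (u : ℝ → En n → ℂ) (v : En n) : ℝ → En n → ℝ :=
  fun t x => (starRingEnd ℂ (u t x) * Dx v u t x).re
/-- time derivative of momentum density -/
def JJt (u : ℝ → En n → ℂ) (v : En n) : ℝ → En n → ℝ :=
  fun t x => (starRingEnd ℂ (Dt u t x) * Dx v u t x + starRingEnd ℂ (u t x) * Dx v (Dt u) t x).im
/-- time derivative of mass density -/
def rhot (u : ℝ → En n → ℂ) : ℝ → En n → ℝ := fun t x => 2 * (starRingEnd ℂ (u t x) * Dt u t x).re

lemma NLSSolution.grho (h : NLSSolution n p lam u) : Good (rho u) := h.g0.normSq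
lemma NLSSolution.gJ (h : NLSSolution n p lam u) (v : En n) : Good (JJ u v) :=
  (h.g0.conj.mul (h.g1 v)).im
lemma NLSSolution.gR (h : NLSSolution n p lam u) (v : En n) : Good (RR u v) :=
  (h.g0.conj.mul (h.g1 v)).re
lemma NLSSolution.gJt (h : NLSSolution n p lam u) (hp : 1 < p) (v : En n) : Good (JJt u v) :=
  (((h.gt hp).conj.mul (h.g1 v)).add (h.g0.conj.mul (h.gtx hp v))).im
lemma NLSSolution.grhot (h : NLSSolution n p lam u) (hp : 1 < p) : Good (rhot u) :=
  ((h.g0.conj.mul (h.gt hp)).re).const_mul 2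

lemma NLSSolution.dJ (h : NLSSolution n p lam u) (v : En n) (t : ℝ) (x : En n) :
    HasDerivAt (fun s => JJ u v s x) (JJt u v t x) t := by
  have := (((h.sm.hasDerivAt t x).conj').mul ((h.sm.Dx v).hasDerivAt t x)).im'
  rw [h.sm.Dt_Dx] at this
  exact this

lemma NLSSolution.drho (h : NLSSolution n p lam u) (t : ℝ) (x : En n) :
    HasDerivAt (fun s => rho u s x) (rhot u t x) t :=
  hasDerivAt_norm_sq_comp (h.sm.hasDerivAt t x)

lemma NLSSolution.lrho (h : NLSSolution n p lam u) (v : En n) (t : ℝ) (x : En n) :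
    HasLineDerivAt ℝ (rho u t) (2 * RR u v t x) x v := by
  have := hasDerivAt_norm_sq_comp (h.sm.line v t x)
  simp only [zero_smul, add_zero] at this
  exact this

lemma inner_eb (w : En n) (k : Fin n) : inner ℝ w (eb k) = w k := by
  simp [eb, EuclideanSpace.inner_single_right]

/-- The interaction action. -/
def act (u : ℝ → En n → ℂ) (w : En n) (a : ℝ → ℝ) (t : ℝ) : ℝ := BB w a (JJ u w t) (rho u t)

lemma NLSSolution.act_deriv (h : NLSSolution n p lam u) (hp : 1 < p) (w : En n) {a : ℝ → ℝ}
    (ha : CB a) (t : ℝ) :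
    HasDerivAt (act u w a) (BB w a (JJt u w t) (rho u t) + BB w a (JJ u w t) (rhot u t)) t := by
  obtain ⟨B, hB⟩ := ha.2
  have g1 := (h.gJ w).tensor h.grho (ha.comp w) (B := B) (fun z => hB _)
  have g2 := (h.gJt hp w).tensor h.grho (ha.comp w) (B := B) (fun z => hB _)
  have g3 := (h.gJ w).tensor (h.grhot hp) (ha.comp w) (B := B) (fun z => hB _)
  have := g1.hasDerivAt_integral (μ := volume) (g2.add g3) (fun t z => by
    have := (((h.dJ w t z.1).mul (h.drho t z.2)).const_mul (a (inner ℝ w (z.1 - z.2))))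
    refine this.congr_deriv ?_
    ring) t
  rw [integral_add (g2.integrable t) (g3.integrable t)] at this
  exact this

lemma NLSSolution.rhot_eq (h : NLSSolution n p lam u) (t : ℝ) (x : En n) :
    rhot u t x = ∑ k, (-2) * (starRingEnd ℂ (Dx (eb k) u t x) * Dx (eb k) u t x
      + starRingEnd ℂ (u t x) * Dx (eb k) (Dx (eb k) u) t x).im := by
  unfold rhot
  rw [h.dt, Lapl, ← Finset.mul_sum, ← Complex.im_sum, Finset.sum_add_distrib, ← Finset.mul_sum]
  generalize (∑ j, Dx (eb j) (Dx (eb j) u) t x) = L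
  have : (∑ k, (starRingEnd ℂ (Dx (eb k) u t x) * Dx (eb k) u t x)).im = 0 := by
    rw [Complex.im_sum]
    refine Finset.sum_eq_zero fun k _ => ?_
    simp; ring
  rw [add_im, this]
  simp
  ring

lemma NLSSolution.T2 (h : NLSSolution n p lam u) (w : En n) {a a' : ℝ → ℝ}
    (ha : CB a) (ha' : CB a') (hd : ∀ s, HasDerivAt a (a' s) s) (t : ℝ) :
    BB w a (JJ u w t) (rhot u t) = -2 * BB w a' (JJ u w t) (JJ u w t) := by
  set F : Fin n → ℝ → En n → ℝ := fun k t x => (starRingEnd ℂ (Dx (eb k) u t x) * Dx (eb k) u t x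
      + starRingEnd ℂ (u t x) * Dx (eb k) (Dx (eb k) u) t x).im with hF
  have gF : ∀ k, Good (F k) := fun k =>
    (((h.g1 _).conj.mul (h.g1 _)).add (h.g0.conj.mul (h.g2 _ _))).im
  have e1 : rhot u t = fun x => ∑ k, (-2) * F k t x := by funext x; exact h.rhot_eq t x
  have lF : ∀ k x, HasLineDerivAt ℝ (JJ u (eb k) t) (F k t x) x (eb k) := by
    intro k x
    have := (((h.sm.line (eb k) t x).conj').mul ((h.sm.Dx (eb k)).line (eb k) t x)).im'
    simp only [zero_smul, add_zero] at this
    exact this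
  have e2 : JJ u w t = fun x => ∑ k, w k * JJ u (eb k) t x := by
    funext x
    unfold JJ
    rw [Dx_sum u w, Finset.mul_sum, Complex.im_sum]
    refine Finset.sum_congr rfl fun k _ => ?_
    simp; ring
  rw [e1, BB_sum_right _ ha (fun k => ((gF k).integrable t).const_mul _) ((h.gJ w).integrable t)]
  conv_rhs => rw [show BB w a' (JJ u w t) (JJ u w t)
    = BB w a' (JJ u w t) (fun x => ∑ k, w k * JJ u (eb k) t x) by rw [← e2]]
  rw [BB_sum_right _ ha' (fun k => ((h.gJ (eb k)).integrable t).const_mul _) ((h.gJ w).integrable t),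
    Finset.mul_sum]
  refine Finset.sum_congr rfl fun k _ => ?_
  rw [BB_smul_right, BB_smul_right, BB_ibp_right ha ha' hd ((h.gJ w).integrable t)
    ((h.gJ _).integrable t) ((gF k).integrable t) (lF k), inner_eb]

end vir

section t1
variable {n : ℕ} {p lam : ℝ} {u : ℝ → En n → ℂ}

/-- stress tensor part -/
def SS (u : ℝ → En n → ℂ) (w : En n) (k : Fin n) : ℝ → En n → ℝ :=
  fun t x => (starRingEnd ℂ (Dx w u t x) * Dx (eb k) u t x).re
/-- its derivative in direction `k` -/
def SSd (u : ℝ → En n → ℂ) (w : En n) (k : Fin n) : ℝ → En n → ℝ :=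
  fun t x => (starRingEnd ℂ (Dx (eb k) (Dx w u) t x) * Dx (eb k) u t x
    + starRingEnd ℂ (Dx w u t x) * Dx (eb k) (Dx (eb k) u) t x).re
/-- derivative of `RR` -/
def RRd (u : ℝ → En n → ℂ) (k : Fin n) : ℝ → En n → ℝ :=
  fun t x => (starRingEnd ℂ (Dx (eb k) u t x) * Dx (eb k) u t x
    + starRingEnd ℂ (u t x) * Dx (eb k) (Dx (eb k) u) t x).re
/-- pressure part -/
def QQ (p lam : ℝ) (u : ℝ → En n → ℂ) : ℝ → En n → ℝ :=
  fun t x => (∑ k, RRd u k t x) + (-(lam * (p - 1) / (p + 1))) * ‖u t x‖ ^ (p + 1)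

lemma NLSSolution.gS (h : NLSSolution n p lam u) (w : En n) (k : Fin n) : Good (SS u w k) :=
  ((h.g1 w).conj.mul (h.g1 _)).re
lemma NLSSolution.gSd (h : NLSSolution n p lam u) (w : En n) (k : Fin n) : Good (SSd u w k) :=
  (((h.g2 _ w).conj.mul (h.g1 _)).add ((h.g1 w).conj.mul (h.g2 _ _))).re
lemma NLSSolution.gRd (h : NLSSolution n p lam u) (k : Fin n) : Good (RRd u k) :=
  (((h.g1 _).conj.mul (h.g1 _)).add (h.g0.conj.mul (h.g2 _ _))).re
lemma NLSSolution.gP (h : NLSSolution n p lam u) (hp : 1 < p) :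
    Good (fun t x => ‖u t x‖ ^ (p + 1)) := h.g0.rpow (by linarith)
lemma NLSSolution.gQ (h : NLSSolution n p lam u) (hp : 1 < p) : Good (QQ p lam u) :=
  (Good.sum _ fun k => h.gRd k).add ((h.gP hp).const_mul _)

lemma NLSSolution.lS (h : NLSSolution n p lam u) (w : En n) (k : Fin n) (t : ℝ) (x : En n) :
    HasLineDerivAt ℝ (SS u w k t) (SSd u w k t x) x (eb k) := by
  have := ((((h.sm.Dx w).line (eb k) t x).conj').mul ((h.sm.Dx (eb k)).line (eb k) t x)).re'
  simp only [zero_smul, add_zero] at this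
  exact this

lemma NLSSolution.lR (h : NLSSolution n p lam u) (k : Fin n) (t : ℝ) (x : En n) :
    HasLineDerivAt ℝ (RR u (eb k) t) (RRd u k t x) x (eb k) := by
  have := (((h.sm.line (eb k) t x).conj').mul ((h.sm.Dx (eb k)).line (eb k) t x)).re'
  simp only [zero_smul, add_zero] at this
  exact this

lemma NLSSolution.QQ_eq (h : NLSSolution n p lam u) (hp : 1 < p) (t : ℝ) (x : En n) :
    QQ p lam u t x = (starRingEnd ℂ (u t x) * Dt u t x).im + ∑ k, ‖Dx (eb k) u t x‖ ^ 2
      + 2 * lam / (p + 1) * ‖u t x‖ ^ (p + 1) := by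
  have hp1 : p + 1 ≠ 0 := by linarith
  unfold QQ RRd
  rw [h.dt, Lapl]
  simp only [add_re]
  rw [Finset.sum_add_distrib]
  have e1 : ∀ k, (starRingEnd ℂ (Dx (eb k) u t x) * Dx (eb k) u t x).re = ‖Dx (eb k) u t x‖ ^ 2 := by
    intro k
    rw [← Complex.normSq_eq_conj_mul_self, Complex.ofReal_re, Complex.normSq_eq_norm_sq]
  have e2 : ∑ k, (starRingEnd ℂ (u t x) * Dx (eb k) (Dx (eb k) u) t x).re
      = (starRingEnd ℂ (u t x) * ∑ k, Dx (eb k) (Dx (eb k) u) t x).re := by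
    rw [Finset.mul_sum, Complex.re_sum]
  simp only [e1]
  rw [e2]
  generalize (∑ k, Dx (eb k) (Dx (eb k) u) t x) = L
  have e3 : ‖u t x‖ ^ (p + 1) = ‖u t x‖ ^ (p - 1) * ((u t x).re ^ 2 + (u t x).im ^ 2) := by
    have : (u t x).re ^ 2 + (u t x).im ^ 2 = ‖u t x‖ ^ 2 := by
      rw [← Complex.normSq_eq_norm_sq, Complex.normSq_apply]; ring
    rw [this, ← Real.rpow_natCast, ← Real.rpow_add' (norm_nonneg _) (by push_cast; linarith)]
    congr 1; push_cast; ring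
  rw [e3]
  simp
  field_simp
  ring

lemma NLSSolution.lQ (h : NLSSolution n p lam u) (hp : 1 < p) (w : En n) (t : ℝ) (x : En n) :
    HasLineDerivAt ℝ (QQ p lam u t) (JJt u w t x + ∑ k, 2 * SSd u w k t x) x w := by
  have hp1 : p + 1 ≠ 0 := by linarith
  have d1 := (((h.sm.line w t x).conj').mul ((h.sm.Dt).line w t x)).im'
  have d2 := HasDerivAt.fun_sum (u := Finset.univ)
    fun (k : Fin n) _ => hasDerivAt_norm_sq_comp ((h.sm.Dx (eb k)).line w t x)
  have d3 := (hasDerivAt_norm_rpow_comp hp (h.sm.line w t x)).const_mul (2 * lam / (p + 1))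
  have d := (d1.add d2).add d3
  simp only [zero_smul, add_zero] at d
  have e : QQ p lam u t = fun x => (starRingEnd ℂ (u t x) * Dt u t x).im
      + ∑ k, ‖Dx (eb k) u t x‖ ^ 2 + 2 * lam / (p + 1) * ‖u t x‖ ^ (p + 1) := by
    funext x; exact h.QQ_eq hp t x
  rw [e]
  refine HasDerivAt.congr_deriv d ?_
  unfold JJt SSd
  rw [h.dt]
  have es : ∑ k, 2 * (starRingEnd ℂ (Dx (eb k) (Dx w u) t x) * Dx (eb k) u t x
    + starRingEnd ℂ (Dx w u t x) * Dx (eb k) (Dx (eb k) u) t x).re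
    = ∑ k, 2 * (starRingEnd ℂ (Dx (eb k) u t x) * Dx w (Dx (eb k) u) t x).re
      + 2 * (starRingEnd ℂ (Dx w u t x) * Lapl u t x).re := by
    rw [Lapl, Finset.mul_sum, Complex.re_sum, Finset.mul_sum, ← Finset.sum_add_distrib]
    refine Finset.sum_congr rfl fun k _ => ?_
    rw [h.sm.Dx_comm w (eb k)]
    simp
    ring
  rw [es]
  generalize (∑ k, 2 * (starRingEnd ℂ (Dx (eb k) u t x) * Dx w (Dx (eb k) u) t x).re) = A
  simp
  field_simp
  ring

lemma NLSSolution.T1 (h : NLSSolution n p lam u) (hp : 1 < p) (w : En n) (hw : inner ℝ w w = (1:ℝ))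
    {a a' a'' : ℝ → ℝ} (ha : CB a) (ha' : CB a') (ha'' : CB a'')
    (hd : ∀ s, HasDerivAt a (a' s) s) (hd' : ∀ s, HasDerivAt a' (a'' s) s) (t : ℝ) :
    BB w a (JJt u w t) (rho u t) = 2 * BB w a' (fun x => ‖Dx w u t x‖ ^ 2) (rho u t)
      + 2 * BB w a' (RR u w t) (RR u w t)
      + lam * (p - 1) / (p + 1) * BB w a' (fun x => ‖u t x‖ ^ (p + 1)) (rho u t) := by
  have ir := h.grho.integrable (μ := volume) t
  have gQd : Good (fun t x => JJt u w t x + ∑ k, 2 * SSd u w k t x) :=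
    (h.gJt hp w).add (Good.sum _ fun k => (h.gSd w k).const_mul 2)
  have a1 := BB_ibp_left (w := w) ha ha' hd ((h.gQ hp).integrable t) (gQd.integrable t) ir (h.lQ hp w t)
  rw [BB_add_left ha ((h.gJt hp w).integrable t)
    ((Good.sum _ fun k => (h.gSd w k).const_mul 2).integrable t) ir,
    BB_sum_left _ ha (fun k => ((h.gSd w k).integrable t).const_mul 2) ir, hw] at a1
  have a2 : ∀ k, BB w a (fun x => 2 * SSd u w k t x) (rho u t)
      = - 2 * BB w a' (fun x => w k * SS u w k t x) (rho u t) := by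
    intro k
    rw [BB_smul_left, BB_smul_left, BB_ibp_left ha ha' hd ((h.gS w k).integrable t)
      ((h.gSd w k).integrable t) ir (h.lS w k t), inner_eb]
    ring
  simp_rw [a2] at a1
  rw [← Finset.mul_sum, ← BB_sum_left _ ha' (fun k => ((h.gS w k).integrable t).const_mul (w k)) ir] at a1
  have e1 : (fun x => ∑ k, w k * SS u w k t x) = fun x => ‖Dx w u t x‖ ^ 2 := by
    funext x
    have e : ‖Dx w u t x‖ ^ 2
        = (starRingEnd ℂ (Dx w u t x) * ∑ k, ((w k : ℝ) : ℂ) * Dx (eb k) u t x).re := by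
      rw [← Dx_sum u w, ← Complex.normSq_eq_conj_mul_self, Complex.normSq_eq_norm_sq,
        Complex.ofReal_re]
    rw [e, Finset.mul_sum, Complex.re_sum]
    refine Finset.sum_congr rfl fun k _ => ?_
    unfold SS
    simp
    ring
  have e2 : (fun x => ∑ k, w k * RR u (eb k) t x) = RR u w t := by
    funext x
    unfold RR
    rw [Dx_sum u w, Finset.mul_sum, Complex.re_sum]
    refine Finset.sum_congr rfl fun k _ => ?_
    simp; ring
  have a3 : BB w a' (QQ p lam u t) (rho u t) = - BB w a'' (RR u w t) (rho u t)
      - lam * (p - 1) / (p + 1) * BB w a' (fun x => ‖u t x‖ ^ (p + 1)) (rho u t) := by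
    unfold QQ
    rw [BB_add_left ha' ((Good.sum _ fun k => h.gRd k).integrable t)
      (((h.gP hp).const_mul _).integrable t) ir, BB_smul_left,
      BB_sum_left _ ha' (fun k => (h.gRd k).integrable t) ir, ← e2,
      BB_sum_left _ ha'' (fun k => ((h.gR _).integrable t).const_mul (w k)) ir, neg_mul, ← sub_eq_add_neg]
    congr 1
    rw [← Finset.sum_neg_distrib]
    refine Finset.sum_congr rfl fun k _ => ?_
    rw [BB_smul_left, BB_ibp_left ha' ha'' hd' ((h.gR _).integrable t)
      ((h.gRd k).integrable t) ir (h.lR k t), inner_eb]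
    ring
  have a4 := BB_ibp_right (w := w) ha' ha'' hd' ((h.gR w).integrable t) ir
    (((h.gR w).const_mul 2).integrable t) (h.lrho w t)
  rw [BB_smul_right, hw] at a4
  rw [e1] at a1
  rw [a3] at a1
  linarith

end t1

section low
variable {n : ℕ} {p lam : ℝ} {u : ℝ → En n → ℂ}

lemma BB_nonneg {w : En n} {a : ℝ → ℝ} {f g : En n → ℝ} (ha : ∀ s, 0 ≤ a s) (hf : ∀ x, 0 ≤ f x)
    (hg : ∀ x, 0 ≤ g x) : 0 ≤ BB w a f g :=
  integral_nonneg fun z => mul_nonneg (ha _) (mul_nonneg (hf _) (hg _))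

lemma abs_JJ_le (w : En n) (t : ℝ) (x : En n) : |JJ u w t x| ≤ ‖u t x‖ * ‖Dx w u t x‖ := by
  refine (Complex.abs_im_le_norm _).trans ?_
  simp

lemma NLSSolution.sym (h : NLSSolution n p lam u) (w : En n)
    {a : ℝ → ℝ} (ha : CB a) (hev : ∀ s, a (-s) = a s) (hnn : ∀ s, 0 ≤ a s) (t : ℝ) :
    BB w a (JJ u w t) (JJ u w t) ≤ BB w a (fun x => ‖Dx w u t x‖ ^ 2) (rho u t) := by
  have i1 := BB_int (w := w) ha ((h.g1 w).normSq.integrable t) (h.grho.integrable t)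
  have i2 := BB_int (w := w) ha (h.grho.integrable t) ((h.g1 w).normSq.integrable t)
  have i3 := BB_int (w := w) ha ((h.gJ w).integrable t) ((h.gJ w).integrable t)
  have e : BB w a (fun x => ‖Dx w u t x‖ ^ 2) (rho u t)
      = BB w a (rho u t) (fun x => ‖Dx w u t x‖ ^ 2) := BB_swap hev
  have : 2 * BB w a (JJ u w t) (JJ u w t) ≤ BB w a (fun x => ‖Dx w u t x‖ ^ 2) (rho u t) +
      BB w a (rho u t) (fun x => ‖Dx w u t x‖ ^ 2) := by
    unfold BB
    rw [← integral_const_mul, ← integral_add i1 i2]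
    refine integral_mono (i3.const_mul 2) (i1.add i2) fun z => ?_
    simp only [Pi.add_apply]
    have h1 := abs_JJ_le (u := u) w t z.1
    have h2 := abs_JJ_le (u := u) w t z.2
    have h3 : JJ u w t z.1 * JJ u w t z.2
        ≤ (‖u t z.1‖ * ‖Dx w u t z.1‖) * (‖u t z.2‖ * ‖Dx w u t z.2‖) := by
      refine (le_abs_self _).trans ?_
      rw [abs_mul]
      gcongr
    have h4 : 2 * (JJ u w t z.1 * JJ u w t z.2) ≤ ‖Dx w u t z.1‖ ^ 2 * rho u t z.2
        + rho u t z.1 * ‖Dx w u t z.2‖ ^ 2 := by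
      unfold rho
      nlinarith [sq_nonneg (‖Dx w u t z.1‖ * ‖u t z.2‖ - ‖u t z.1‖ * ‖Dx w u t z.2‖)]
    nlinarith [mul_le_mul_of_nonneg_left h4 (hnn (inner ℝ w (z.1 - z.2)))]
  linarith

lemma NLSSolution.act_lower (h : NLSSolution n p lam u) (hp : 1 < p) (hl : 0 < lam) (w : En n)
    (hw : inner ℝ w w = (1:ℝ))
    {a a' a'' : ℝ → ℝ} (ha : CB a) (ha' : CB a') (ha'' : CB a'')
    (hd : ∀ s, HasDerivAt a (a' s) s) (hd' : ∀ s, HasDerivAt a' (a'' s) s)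
    (hev : ∀ s, a' (-s) = a' s) (hnn : ∀ s, 0 ≤ a' s) (t : ℝ) :
    ∃ D, HasDerivAt (act u w a) D t ∧ 2 * BB w a' (RR u w t) (RR u w t) ≤ D := by
  refine ⟨_, h.act_deriv hp w ha t, ?_⟩
  rw [h.T1 hp w hw ha ha' ha'' hd hd', h.T2 w ha ha' hd]
  have h1 := h.sym w ha' hev hnn t
  have h2 : 0 ≤ BB w a' (fun x => ‖u t x‖ ^ (p + 1)) (rho u t) :=
    BB_nonneg hnn (fun x => by positivity) (fun x => by unfold rho; positivity)
  have h3 : 0 ≤ lam * (p - 1) / (p + 1) :=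
    div_nonneg (mul_nonneg hl.le (by linarith)) (by linarith)
  nlinarith [mul_nonneg h3 h2]

lemma Dx_sq_le (w : En n) (hw : inner ℝ w w = (1:ℝ)) (t : ℝ) (x : En n) :
    ‖Dx w u t x‖ ^ 2 ≤ ∑ k, ‖Dx (eb k) u t x‖ ^ 2 := by
  rw [Dx_sum u w]
  have h1 : ‖∑ k, ((w k : ℝ) : ℂ) * Dx (eb k) u t x‖ ≤ ∑ k, ‖w k‖ * ‖Dx (eb k) u t x‖ := by
    refine (norm_sum_le _ _).trans (le_of_eq ?_)
    refine Finset.sum_congr rfl fun k _ => ?_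
    simp
  have h2 := Finset.sum_mul_sq_le_sq_mul_sq Finset.univ (fun k => ‖w k‖) (fun k => ‖Dx (eb k) u t x‖)
  have h3 : ∑ k, ‖w k‖ ^ 2 = 1 := by
    rw [← EuclideanSpace.norm_sq_eq, ← real_inner_self_eq_norm_sq, hw]
  rw [h3, one_mul] at h2
  exact (pow_le_pow_left₀ (norm_nonneg _) h1 2).trans h2

lemma NLSSolution.act_bound (h : NLSSolution n p lam u) (hp : 1 < p) (hl : 0 < lam) (w : En n)
    (hw : inner ℝ w w = (1:ℝ)) {a : ℝ → ℝ} (ha : CB a) (hb : ∀ s, |a s| ≤ 1) (t : ℝ) :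
    |act u w a t| ≤ (Real.sqrt (∫ x, ‖u 0 x‖ ^ 2)) ^ 3 *
      ⨆ t : ℝ, Real.sqrt (∫ x : En n, ∑ j, ‖pd j (u t) x‖ ^ 2) := by
  set m := Real.sqrt (∫ x, ‖u 0 x‖ ^ 2)
  have hm : m ^ 2 = ∫ x, ‖u 0 x‖ ^ 2 := Real.sq_sqrt (integral_nonneg fun x => by positivity)
  have iu := h.g0.normSq.integrable (μ := volume) t
  have ig := (Good.sum Finset.univ fun k => (h.g1 (eb k)).normSq).integrable (μ := volume) t
  have iw := (h.g1 w).normSq.integrable (μ := volume) t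
  have ij := (h.gJ w).integrable (μ := volume) t
  have s1 : |act u w a t| ≤ (∫ x, |JJ u w t x|) * ∫ x, ‖u t x‖ ^ 2 := by
    rw [← integral_prod_mul]
    unfold act BB
    rw [← Real.norm_eq_abs]
    refine (norm_integral_le_integral_norm _).trans ?_
    refine integral_mono_of_nonneg (.of_forall fun z => norm_nonneg _) (ij.abs.mul_prod iu)
      (.of_forall fun z => ?_)
    simp only [norm_mul, Real.norm_eq_abs, rho, abs_pow, abs_norm]
    exact mul_le_of_le_one_left (by positivity) (hb _)
  have i2 : Integrable (fun x => ‖u t x‖ * ‖Dx w u t x‖) := by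
    have := (h.g0.mul (h.g1 w)).integrable (μ := volume) t
    simpa using this.norm
  have s2 : ∫ x, |JJ u w t x| ≤ ∫ x, ‖u t x‖ * ‖Dx w u t x‖ :=
    integral_mono ij.abs i2 fun x => abs_JJ_le w t x
  have s3 : (∫ x, ‖u t x‖ * ‖Dx w u t x‖) ≤
      m * Real.sqrt (∫ x : En n, ∑ j, ‖pd j (u t) x‖ ^ 2) := by
    have hq : (2:ℝ).HolderConjugate 2 := by
      constructor <;> norm_num
    have cs := integral_mul_le_Lp_mul_Lq_of_nonneg (μ := volume) hq (f := fun x => ‖u t x‖)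
      (g := fun x => ‖Dx w u t x‖) (.of_forall fun _ => norm_nonneg _)
      (.of_forall fun _ => norm_nonneg _)
      (by
        have := (memLp_two_iff_integrable_sq_norm (h.g0.cont t).aestronglyMeasurable).2 iu
        simpa using this.norm)
      (by
        have := (memLp_two_iff_integrable_sq_norm ((h.g1 w).cont t).aestronglyMeasurable).2 iw
        simpa using this.norm)
    refine cs.trans ?_
    simp only [Real.rpow_two, ← Real.sqrt_eq_rpow]
    rw [h.mass hp t]
    refine mul_le_mul_of_nonneg_left (Real.sqrt_le_sqrt ?_) (Real.sqrt_nonneg _)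
    exact integral_mono iw ig fun x => Dx_sq_le w hw t x
  have s4 := le_ciSup (h.bddAbove hp hl) t
  rw [h.mass hp t, ← hm] at s1
  have hm0 : 0 ≤ m := Real.sqrt_nonneg _
  calc _ ≤ _ := s1
    _ ≤ (m * ⨆ t : ℝ, Real.sqrt (∫ x : En n, ∑ j, ‖pd j (u t) x‖ ^ 2)) * m ^ 2 := by
        gcongr
        exact (s2.trans s3).trans (mul_le_mul_of_nonneg_left s4 hm0)
    _ = _ := by ring

end low

/-- The Gaussian kernel. -/
def GG (b s : ℝ) : ℝ := 1 / Real.sqrt b * Real.exp (-(Real.pi / b) * s ^ 2)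
/-- Its derivative. -/
def GG1 (b s : ℝ) : ℝ := 1 / Real.sqrt b * (Real.exp (-(Real.pi / b) * s ^ 2) * (-(Real.pi / b) * (2 * s)))
/-- Its primitive. -/
def HH (b s : ℝ) : ℝ := ∫ x in (0:ℝ)..s, GG b x

lemma GG_cont (b : ℝ) : Continuous (GG b) := by unfold GG; fun_prop
lemma GG_nonneg (b s : ℝ) : 0 ≤ GG b s := by unfold GG; positivity
lemma GG_even (b s : ℝ) : GG b (-s) = GG b s := by unfold GG; simp
lemma GG_CB {b : ℝ} (hb : 0 < b) : CB (GG b) := by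
  refine ⟨GG_cont b, 1 / Real.sqrt b, fun s => ?_⟩
  rw [abs_of_nonneg (GG_nonneg b s)]
  unfold GG
  refine mul_le_of_le_one_right (by positivity) (Real.exp_le_one_iff.2 ?_)
  have : 0 ≤ Real.pi / b * s ^ 2 := by positivity
  linarith

lemma GG_deriv (b s : ℝ) : HasDerivAt (GG b) (GG1 b s) s := by
  have h : HasDerivAt (fun s : ℝ => -(Real.pi / b) * s ^ 2) (-(Real.pi / b) * (2 * s)) s := by
    simpa using (hasDerivAt_pow 2 s).const_mul (-(Real.pi / b))
  exact h.exp.const_mul _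

lemma GG1_CB {b : ℝ} (hb : 0 < b) : CB (GG1 b) := by
  refine ⟨by unfold GG1; fun_prop,
    1 / Real.sqrt b * (Real.pi / b * (2 * (1 + 1 / (Real.pi / b)))), fun s => ?_⟩
  unfold GG1
  have hc : 0 < Real.pi / b := by positivity
  generalize Real.pi / b = c at *
  rw [abs_mul, abs_of_nonneg (by positivity : 0 ≤ 1 / Real.sqrt b), abs_mul, abs_mul, abs_neg,
    abs_of_pos hc, abs_mul, abs_two, abs_of_pos (Real.exp_pos _)]
  refine mul_le_mul_of_nonneg_left ?_ (by positivity)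
  have h1 : |s| ≤ (1 + 1 / c) * (1 + c * s ^ 2) := by
    have : (1 + 1 / c) * (1 + c * s ^ 2) = 1 + c * s ^ 2 + 1 / c + s ^ 2 := by field_simp; ring
    rw [this]
    have : 0 < 1 / c := by positivity
    have : 0 ≤ c * s ^ 2 := by positivity
    nlinarith [sq_nonneg (|s| - 1), sq_abs s, abs_nonneg s]
  have h2 : 1 + c * s ^ 2 ≤ Real.exp (c * s ^ 2) := by
    have := Real.add_one_le_exp (c * s ^ 2); linarith
  have h3 : Real.exp (-c * s ^ 2) * |s| ≤ 1 + 1 / c := by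
    have h4 : Real.exp (-c * s ^ 2) * Real.exp (c * s ^ 2) = 1 := by
      rw [← Real.exp_add]; simp
    calc Real.exp (-c * s ^ 2) * |s| ≤ Real.exp (-c * s ^ 2) * ((1 + 1 / c) * Real.exp (c * s ^ 2)) := by
          gcongr
          exact h1.trans (by gcongr)
      _ = (1 + 1 / c) * (Real.exp (-c * s ^ 2) * Real.exp (c * s ^ 2)) := by ring
      _ = _ := by rw [h4, mul_one]
  calc Real.exp (-c * s ^ 2) * (c * (2 * |s|)) = c * (2 * (Real.exp (-c * s ^ 2) * |s|)) := by ring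
    _ ≤ _ := by gcongr

lemma GG_integrable {b : ℝ} (hb : 0 < b) : Integrable (GG b) :=
  (integrable_exp_neg_mul_sq (by positivity : 0 < Real.pi / b)).const_mul _

lemma GG_integral {b : ℝ} (hb : 0 < b) : ∫ s, GG b s = 1 := by
  unfold GG
  rw [integral_const_mul, integral_gaussian]
  have : Real.pi / (Real.pi / b) = b := by field_simp
  rw [this]
  have : Real.sqrt b ≠ 0 := (Real.sqrt_pos.2 hb).ne'
  field_simp

lemma HH_deriv (b s : ℝ) : HasDerivAt (HH b) (GG b s) s :=
  ((GG_cont b).integral_hasStrictDerivAt 0 s).hasDerivAt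

lemma HH_le {b : ℝ} (hb : 0 < b) (s : ℝ) : |HH b s| ≤ 1 := by
  unfold HH
  rw [← Real.norm_eq_abs, ← GG_integral hb]
  refine intervalIntegral.norm_integral_le_integral_norm_uIoc.trans ?_
  simp_rw [Real.norm_of_nonneg (GG_nonneg b _)]
  exact setIntegral_le_integral (GG_integrable hb) (.of_forall (GG_nonneg b))

lemma HH_CB {b : ℝ} (hb : 0 < b) : CB (HH b) :=
  ⟨continuous_iff_continuousAt.2 fun s => (HH_deriv b s).continuousAt, 1, HH_le hb⟩

/-- phase -/
def ee (θ : ℝ) : ℂ := cexp (((-2 * Real.pi * θ : ℝ) : ℂ) * I)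

lemma ee_norm (θ : ℝ) : ‖ee θ‖ = 1 := Complex.norm_exp_ofReal_mul_I _
lemma ee_cont : Continuous ee := by unfold ee; fun_prop
lemma ee_sub (θ η : ℝ) : ee (θ - η) = ee θ * starRingEnd ℂ (ee η) := by
  unfold ee
  rw [← Complex.exp_conj, ← Complex.exp_add]
  congr 1
  rw [map_mul, Complex.conj_ofReal, Complex.conj_I]
  push_cast
  ring

lemma GG_fourier {b : ℝ} (hb : 0 < b) (s : ℝ) :
    ((GG b s : ℝ) : ℂ) = ∫ r : ℝ, ee (r * s) * ((Real.exp (-(Real.pi * b) * r ^ 2) : ℝ) : ℂ) := by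
  have := congrFun (fourier_gaussian_pi (b := (b : ℂ)) (by simpa using hb)) s
  rw [Real.fourier_eq'] at this
  have e1 : ((GG b s : ℝ) : ℂ)
      = 1 / (b : ℂ) ^ ((1 : ℂ) / 2) * cexp (-(Real.pi : ℂ) / b * (s : ℂ) ^ 2) := by
    unfold GG
    rw [Real.sqrt_eq_rpow]
    push_cast
    rw [Complex.ofReal_cpow hb.le]
    push_cast
    congr 2
    ring
  rw [e1, ← this]
  congr 1; funext r
  unfold ee
  rw [smul_eq_mul]
  congr 2
  · simp; ring
  · push_cast; congr 1; ring

section four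
variable {n : ℕ}

lemma fourier_ee (f : En n → ℂ) (ξ : En n) : 𝓕 f ξ = ∫ x, ee (inner ℝ x ξ) * f x := by
  rw [Real.fourier_eq']; rfl

lemma BB_fourier {b : ℝ} (hb : 0 < b) (w : En n) {f : En n → ℝ} (hf : Integrable f) :
    BB w (GG b) f f = ∫ r : ℝ, Real.exp (-(Real.pi * b) * r ^ 2) *
      ‖𝓕 (fun x => ((f x : ℝ) : ℂ)) (r • w)‖ ^ 2 := by
  have hfc : Integrable (fun x => ((f x : ℝ) : ℂ)) := hf.ofReal
  have key : ∀ r : ℝ, ((‖𝓕 (fun x => ((f x : ℝ) : ℂ)) (r • w)‖ ^ 2 : ℝ) : ℂ)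
      = ∫ z : En n × En n, ee (r * inner ℝ w (z.1 - z.2)) * (((f z.1 : ℝ) : ℂ) * ((f z.2 : ℝ) : ℂ)) := by
    intro r
    rw [← Complex.normSq_eq_norm_sq, Complex.normSq_eq_conj_mul_self, mul_comm, fourier_ee,
      ← integral_conj]
    rw [← integral_prod_mul]
    congr 1; funext z
    rw [inner_sub_right, mul_sub, ee_sub]
    simp only [map_mul, Complex.conj_ofReal, inner_smul_right, real_inner_comm w]
    ring
  have swap := integral_integral_swap (μ := (volume : Measure ℝ)) (ν := (volume : Measure (En n × En n)))
    (f := fun r z => ((Real.exp (-(Real.pi * b) * r ^ 2) : ℝ) : ℂ) *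
      (ee (r * inner ℝ w (z.1 - z.2)) * (((f z.1 : ℝ) : ℂ) * ((f z.2 : ℝ) : ℂ)))) ?_
  · have e1 : ((∫ r : ℝ, Real.exp (-(Real.pi * b) * r ^ 2) *
      ‖𝓕 (fun x => ((f x : ℝ) : ℂ)) (r • w)‖ ^ 2 : ℝ) : ℂ) = ((BB w (GG b) f f : ℝ) : ℂ) := by
      rw [← integral_complex_ofReal]
      unfold BB
      rw [← integral_complex_ofReal]
      refine Eq.trans ?_ (swap.trans ?_)
      · congr 1; funext r
        rw [integral_const_mul, ← key r]
        push_cast; rfl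
      · congr 1; funext z
        rw [Complex.ofReal_mul, Complex.ofReal_mul, GG_fourier hb, ← integral_mul_const]
        congr 1; funext r
        ring
    exact_mod_cast e1.symm
  · have i0 : Integrable (fun r : ℝ => ((Real.exp (-(Real.pi * b) * r ^ 2) : ℝ) : ℂ)) :=
      (integrable_exp_neg_mul_sq (by positivity : 0 < Real.pi * b)).ofReal
    have i1 : Integrable (fun z : En n × En n => ((f z.1 : ℝ) : ℂ) * ((f z.2 : ℝ) : ℂ)) :=
      hfc.mul_prod hfc
    have i2 := i0.mul_prod i1
    have := i2.bdd_mul (c := 1) (f := fun q : ℝ × En n × En n => ee (q.1 * inner ℝ w (q.2.1 - q.2.2)))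
      (ee_cont.comp (by fun_prop)).aestronglyMeasurable (.of_forall fun q => (ee_norm _).le)
    refine this.congr (.of_forall fun q => ?_)
    simp only [Function.uncurry]
    ring

lemma fourier_line {f f' : En n → ℂ} {v : En n} (hf : Integrable f) (hf' : Integrable f')
    (h : ∀ x, HasLineDerivAt ℝ f (f' x) x v) (ξ : En n) :
    𝓕 f' ξ = 2 * Real.pi * I * ((inner ℝ v ξ : ℝ) : ℂ) * 𝓕 f ξ := by
  have c : Continuous fun x : En n => ee (inner ℝ x ξ) := ee_cont.comp (by fun_prop)
  have i : ∀ {g : En n → ℂ}, Integrable g → Integrable fun x => ee (inner ℝ x ξ) * g x := fun hg =>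
    hg.bdd_mul (c := 1) c.aestronglyMeasurable (.of_forall fun q => (ee_norm _).le)
  have := integral_bilinear_hasLineDerivAt_right_eq_neg_left_of_integrable (μ := volume)
    (f := fun x : En n => ee (inner ℝ x ξ))
    (f' := fun x => ee (inner ℝ x ξ) * (((-2 * Real.pi * inner ℝ v ξ : ℝ) : ℂ) * I))
    (g := f) (g' := f') (v := v) (B := ContinuousLinearMap.mul ℝ ℂ) ?_ (i hf') (i hf) ?_ (fun x _ => h x)
  · simp only [ContinuousLinearMap.mul_apply'] at this
    rw [fourier_ee, fourier_ee, this, ← integral_neg, ← integral_const_mul]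
    congr 1; funext x
    push_cast; ring
  · have := (i hf).const_mul (((-2 * Real.pi * inner ℝ v ξ : ℝ) : ℂ) * I)
    refine this.congr (.of_forall fun x => ?_)
    simp only [ContinuousLinearMap.mul_apply']
    ring
  · intro x _
    unfold HasLineDerivAt ee
    have h1 : HasDerivAt (fun t : ℝ => -2 * Real.pi * inner ℝ (x + t • v) ξ)
        (-2 * Real.pi * inner ℝ v ξ) 0 := by
      refine HasDerivAt.const_mul (-2 * Real.pi) ?_
      have : (fun t : ℝ => inner ℝ (x + t • v) ξ) = fun t => inner ℝ x ξ + t * inner ℝ v ξ := by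
        funext t; rw [inner_add_left, real_inner_smul_left]
      rw [this]
      simpa using ((hasDerivAt_id (0:ℝ)).mul_const (inner ℝ v ξ)).const_add (inner ℝ x ξ)
    have h2 := (h1.ofReal_comp.mul_const I).cexp
    simp only [zero_smul, add_zero] at h2
    exact h2

lemma NLSSolution.BB_RR {p lam : ℝ} {u : ℝ → En n → ℂ} (h : NLSSolution n p lam u) (w : En n)
    (hw : inner ℝ w w = (1:ℝ)) {b : ℝ} (hb : 0 < b) (t : ℝ) :
    2 * BB w (GG b) (RR u w t) (RR u w t) = ∫ r : ℝ, Real.exp (-(Real.pi * b) * r ^ 2) *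
      (2 * Real.pi ^ 2 * r ^ 2 * ‖𝓕 (fun x => ((‖u t x‖ ^ 2 : ℝ) : ℂ)) (r • w)‖ ^ 2) := by
  rw [BB_fourier hb w ((h.gR w).integrable t), ← integral_const_mul]
  congr 1; funext r
  have i1 := h.grho.integrable (μ := volume) t
  have i2 := ((h.gR w).const_mul 2).integrable (μ := volume) t
  have := fourier_line (f := fun x => ((‖u t x‖ ^ 2 : ℝ) : ℂ)) (f' := fun x => ((2 * RR u w t x : ℝ) : ℂ))
    (v := w) i1.ofReal i2.ofReal (fun x => HasDerivAt.ofReal_comp (h.lrho w t x)) (r • w)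
  have e : 𝓕 (fun x => ((2 * RR u w t x : ℝ) : ℂ)) (r • w) = 2 * 𝓕 (fun x => ((RR u w t x : ℝ) : ℂ)) (r • w) := by
    rw [fourier_ee, fourier_ee, ← integral_const_mul]
    congr 1; funext x; push_cast; ring
  rw [e, inner_smul_right, hw, mul_one] at this
  have h2 : 𝓕 (fun x => ((RR u w t x : ℝ) : ℂ)) (r • w)
      = Real.pi * I * r * 𝓕 (fun x => ((‖u t x‖ ^ 2 : ℝ) : ℂ)) (r • w) := by
    have h3 : (2:ℂ) ≠ 0 := two_ne_zero
    apply mul_left_cancel₀ h3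
    rw [this]; ring
  rw [h2]
  simp only [norm_mul, Complex.norm_real, Complex.norm_I, mul_pow, Real.norm_eq_abs, sq_abs]
  ring

end four

/-- squared modulus of the Fourier transform of the mass density -/
def FF {n : ℕ} (u : ℝ → En n → ℂ) (t : ℝ) (ξ : En n) : ℝ :=
  ‖𝓕 (fun x : En n => ((‖u t x‖ ^ 2 : ℝ) : ℂ)) ξ‖ ^ 2

/-- the right-hand side quantity -/
def MM {n : ℕ} (u : ℝ → En n → ℂ) : ℝ :=
  (Real.sqrt (∫ x, ‖u 0 x‖ ^ 2)) ^ 3 *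
      ⨆ t : ℝ, Real.sqrt (∫ x : En n, ∑ j, ‖pd j (u t) x‖ ^ 2)

section tm
variable {n : ℕ} {p lam : ℝ} {u : ℝ → En n → ℂ}

lemma Good.continuous_integral {E : Type*} [NormedAddCommGroup E] [NormedSpace ℝ E]
    [FiniteDimensional ℝ E] [MeasurableSpace E] [BorelSpace E] {μ : Measure E} [μ.IsAddHaarMeasure]
    {f : ℝ → E → ℝ} (hf : Good f) : Continuous fun t => ∫ x, f t x ∂μ := by
  refine continuous_iff_continuousAt.2 fun t => ?_
  obtain ⟨b, hb, h⟩ := hf.dom (μ := μ) (|t| + 1)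
  refine continuousAt_of_dominated (bound := b)
    (.of_forall fun s => (hf.cont s).aestronglyMeasurable) ?_ hb (.of_forall fun x => ?_)
  · filter_upwards [Metric.ball_mem_nhds t one_pos] with s hs
    refine .of_forall (h s ?_)
    rw [Metric.mem_ball, Real.dist_eq] at hs
    have := abs_sub_abs_le_abs_sub s t
    linarith
  · exact (hf.1.comp (by fun_prop : Continuous fun s : ℝ => (s, x))).continuousAt

lemma NLSSolution.FF_meas (h : NLSSolution n p lam u) :
    Measurable fun q : ℝ × En n => FF u q.1 q.2 := by
  have : StronglyMeasurable fun q : ℝ × En n => 𝓕 (fun x : En n => ((‖u q.1 x‖ ^ 2 : ℝ) : ℂ)) q.2 := by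
    simp_rw [fourier_ee]
    refine StronglyMeasurable.integral_prod_right (f := fun (q : ℝ × En n) (x : En n) =>
      ee (inner ℝ x q.2) * ((‖u q.1 x‖ ^ 2 : ℝ) : ℂ)) ?_
    refine Continuous.stronglyMeasurable ?_
    refine Continuous.mul (ee_cont.comp (by fun_prop)) ?_
    refine Complex.continuous_ofReal.comp ?_
    exact (h.g0.1.comp (by fun_prop : Continuous fun z : (ℝ × En n) × En n => (z.1.1, z.2))).norm.pow 2
  exact (this.norm.measurable.pow_const 2)

lemma NLSSolution.FF_le (h : NLSSolution n p lam u) (t : ℝ) (ξ : En n) :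
    FF u t ξ ≤ (∫ x, ‖u t x‖ ^ 2) ^ 2 := by
  unfold FF
  refine pow_le_pow_left₀ (norm_nonneg _) ?_ 2
  rw [fourier_ee]
  refine (norm_integral_le_integral_norm _).trans (le_of_eq ?_)
  congr 1; funext x
  rw [norm_mul, ee_norm, one_mul, Complex.norm_real, norm_pow, norm_norm]

/-- the regularized integrand -/
def gi (u : ℝ → En n → ℂ) (w : En n) (b t r : ℝ) : ℝ :=
  Real.exp (-(Real.pi * b) * r ^ 2) * (2 * Real.pi ^ 2 * r ^ 2 * FF u t (r • w))

lemma gi_nonneg (w : En n) (b t r : ℝ) : 0 ≤ gi u w b t r := by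
  unfold gi FF; positivity

lemma NLSSolution.FFw_meas (h : NLSSolution n p lam u) (w : En n) :
    Measurable fun q : ℝ × ℝ => FF u q.1 (q.2 • w) := by
  have hc : Continuous fun q : ℝ × ℝ => (q.1, q.2 • w) :=
    continuous_fst.prodMk (continuous_snd.smul continuous_const)
  have hm : Measurable fun q : ℝ × ℝ => (q.1, q.2 • w) := hc.measurable
  have hF := h.FF_meas
  generalize FF u = F at hF ⊢
  exact hF.comp hm

lemma NLSSolution.gi_meas (h : NLSSolution n p lam u) (w : En n) (b : ℝ) :
    Measurable fun q : ℝ × ℝ => gi u w b q.1 q.2 := by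
  have := h.FFw_meas w
  unfold gi
  fun_prop

lemma NLSSolution.gi_int (h : NLSSolution n p lam u) (w : En n) {b : ℝ} (hb : 0 < b) (t : ℝ) :
    Integrable fun r => gi u w b t r := by
  have i := integrable_rpow_mul_exp_neg_mul_sq (by positivity : 0 < Real.pi * b) (s := 2) (by norm_num)
  refine (i.const_mul (2 * Real.pi ^ 2 * (∫ x, ‖u t x‖ ^ 2) ^ 2)).mono'
    ((h.gi_meas w b).comp (by fun_prop : Measurable fun r : ℝ => (t, r))).aestronglyMeasurable
    (.of_forall fun r => ?_)
  rw [Real.norm_of_nonneg (gi_nonneg w b t r), Real.rpow_two]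
  have := h.FF_le t (r • w)
  unfold gi
  calc _ ≤ Real.exp (-(Real.pi * b) * r ^ 2) * (2 * Real.pi ^ 2 * r ^ 2 * (∫ x, ‖u t x‖ ^ 2) ^ 2) := by
        gcongr
    _ = _ := by ring

lemma NLSSolution.time_int (h : NLSSolution n p lam u) (hp : 1 < p) (hl : 0 < lam) (w : En n)
    (hw : inner ℝ w w = (1:ℝ)) {b : ℝ} (hb : 0 < b) {T : ℝ} (hT : 0 ≤ T) :
    ∫⁻ t in Set.Ioc (-T) T, ∫⁻ r, ENNReal.ofReal (gi u w b t r) ≤ ENNReal.ofReal (2 * MM u) := by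
  have hc : Continuous fun t => ∫ r, gi u w b t r := by
    have e : (fun t => ∫ r, gi u w b t r) = fun t => 2 * BB w (GG b) (RR u w t) (RR u w t) := by
      funext t; exact (h.BB_RR w hw hb t).symm
    rw [e]
    obtain ⟨B, hB⟩ := (GG_CB hb).2
    exact continuous_const.mul ((h.gR w).tensor (h.gR w) ((GG_CB hb).comp w) (B := B)
      (fun z => hB _)).continuous_integral
  choose D hD hDl using fun t => h.act_lower hp hl w hw (HH_CB hb) (GG_CB hb) (GG1_CB hb) (HH_deriv b)
    (GG_deriv b) (GG_even b) (GG_nonneg b) t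
  have key := intervalIntegral.integral_le_sub_of_hasDeriv_right_of_le (a := -T) (b := T)
    (g := act u w (HH b)) (g' := D) (φ := fun t => ∫ r, gi u w b t r) (by linarith)
    (fun t _ => (hD t).continuousAt.continuousWithinAt) (fun t _ => (hD t).hasDerivWithinAt)
    (hc.continuousOn.integrableOn_compact isCompact_Icc)
    (fun t _ => (h.BB_RR w hw hb t).symm.le.trans (hDl t))
  have b1 := abs_le.1 (h.act_bound hp hl w hw (HH_CB hb) (HH_le hb) T)
  have b2 := abs_le.1 (h.act_bound hp hl w hw (HH_CB hb) (HH_le hb) (-T))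
  have key2 : ∫ t in (-T)..T, ∫ r, gi u w b t r ≤ 2 * MM u := by
    unfold MM; linarith [b1.1, b1.2, b2.1, b2.2]
  rw [intervalIntegral.integral_of_le (by linarith)] at key2
  refine le_trans (le_of_eq ?_) (ENNReal.ofReal_le_ofReal key2)
  rw [ofReal_integral_eq_lintegral_ofReal]
  · congr 1; funext t
    rw [ofReal_integral_eq_lintegral_ofReal (h.gi_int w hb t) (.of_forall (gi_nonneg w b t))]
  · exact (hc.continuousOn.integrableOn_compact isCompact_Icc).mono_set Set.Ioc_subset_Icc_self
  · exact .of_forall fun t => integral_nonneg (gi_nonneg w b t)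

lemma NLSSolution.time_int2 (h : NLSSolution n p lam u) (hp : 1 < p) (hl : 0 < lam) (w : En n)
    (hw : inner ℝ w w = (1:ℝ)) {b : ℝ} (hb : 0 < b) :
    ∫⁻ t, ∫⁻ r, ENNReal.ofReal (gi u w b t r) ≤ ENNReal.ofReal (2 * MM u) := by
  have hm : Measurable fun t => ∫⁻ r, ENNReal.ofReal (gi u w b t r) :=
    Measurable.lintegral_prod_right' (f := fun q : ℝ × ℝ => ENNReal.ofReal (gi u w b q.1 q.2))
      (h.gi_meas w b).ennreal_ofReal
  have hc := aecover_Ioc (μ := (volume : Measure ℝ)) (l := Filter.atTop) (a := fun k : ℕ => -(k:ℝ))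
    (b := fun k : ℕ => (k:ℝ)) (Filter.tendsto_neg_atTop_atBot.comp tendsto_natCast_atTop_atTop)
    tendsto_natCast_atTop_atTop
  exact le_of_tendsto (hc.lintegral_tendsto_of_countably_generated hm.aemeasurable)
    (.of_forall fun k => h.time_int hp hl w hw hb (by positivity))

lemma NLSSolution.time_int3 (h : NLSSolution n p lam u) (hp : 1 < p) (hl : 0 < lam) (w : En n)
    (hw : inner ℝ w w = (1:ℝ)) :
    ∫⁻ t, ∫⁻ r, ENNReal.ofReal (gi u w 0 t r) ≤ ENNReal.ofReal (2 * MM u) := by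
  have e : ∀ b, ∫⁻ t, ∫⁻ r, ENNReal.ofReal (gi u w b t r)
      = ∫⁻ q : ℝ × ℝ, ENNReal.ofReal (gi u w b q.1 q.2) ∂(volume.prod volume) := fun b =>
    (lintegral_prod (fun q : ℝ × ℝ => ENNReal.ofReal (gi u w b q.1 q.2))
      (h.gi_meas w b).ennreal_ofReal.aemeasurable).symm
  rw [e]
  have := lintegral_tendsto_of_tendsto_of_monotone (μ := (volume : Measure ℝ).prod volume)
    (f := fun (k : ℕ) (q : ℝ × ℝ) => ENNReal.ofReal (gi u w (1 / ((k:ℝ) + 1)) q.1 q.2))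
    (F := fun q => ENNReal.ofReal (gi u w 0 q.1 q.2))
    (fun k => (h.gi_meas w _).ennreal_ofReal.aemeasurable)
    (.of_forall fun q k l hkl => ?_) (.of_forall fun q => ?_)
  · refine le_of_tendsto this (.of_forall fun k => ?_)
    rw [← e]
    exact h.time_int2 hp hl w hw (by positivity)
  · refine ENNReal.ofReal_le_ofReal ?_
    unfold gi
    have hkl' : (k:ℝ) ≤ l := by exact_mod_cast hkl
    have h1 : 1 / ((l:ℝ) + 1) ≤ 1 / ((k:ℝ) + 1) := by gcongr
    refine mul_le_mul_of_nonneg_right (Real.exp_le_exp.2 ?_) (by unfold FF; positivity)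
    have := mul_le_mul_of_nonneg_left h1 (by positivity : 0 ≤ Real.pi * q.2 ^ 2)
    linarith
  · have hc : Continuous fun b => gi u w b q.1 q.2 := by unfold gi; fun_prop
    exact (ENNReal.continuous_ofReal.comp hc).continuousAt.tendsto.comp
      tendsto_one_div_add_atTop_nhds_zero_nat

end tm

lemma lintegral_polar {n : ℕ} (hn : 0 < n) {f : En n → ENNReal} (hf : Measurable f) :
    ∫⁻ ξ, f ξ = ∫⁻ σ : Metric.sphere (0 : En n) 1, (∫⁻ r in Set.Ioi (0:ℝ),
      ENNReal.ofReal (r ^ (n - 1)) * f (r • (σ : En n))) ∂(volume : Measure (En n)).toSphere := by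
  have : Nonempty (Fin n) := ⟨⟨0, hn⟩⟩
  have : Nontrivial (En n) := inferInstance
  have e1 : ∫⁻ ξ, f ξ = ∫⁻ ξ in ({0}ᶜ : Set (En n)), f ξ := by
    rw [restrict_compl_singleton]
  have mp := (volume : Measure (En n)).measurePreserving_homeomorphUnitSphereProd
  have hd : Module.finrank ℝ (En n) - 1 = n - 1 := by simp
  rw [hd] at mp
  rw [e1, ← lintegral_subtype_comap (by measurability)]
  have e2 := mp.lintegral_comp_emb (Homeomorph.measurableEmbedding _)
    (fun y => f (((homeomorphUnitSphereProd (En n)).symm y : ({0}ᶜ : Set (En n))) : En n))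
  simp only [Homeomorph.symm_apply_apply] at e2
  rw [e2]
  simp only [homeomorphUnitSphereProd_symm_apply_coe]
  have hm : Measurable fun z : Metric.sphere (0 : En n) 1 × Set.Ioi (0:ℝ) => f ((z.2 : ℝ) • (z.1 : En n)) := by
    have hc : Continuous fun z : Metric.sphere (0 : En n) 1 × Set.Ioi (0:ℝ) => (z.2 : ℝ) • (z.1 : En n) := by
      fun_prop
    exact hf.comp hc.measurable
  rw [lintegral_prod _ hm.aemeasurable]
  congr 1; funext σ
  have hσ : Measurable fun y : Set.Ioi (0:ℝ) => f ((y : ℝ) • (σ : En n)) :=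
    hm.comp (measurable_const.prodMk measurable_id)
  rw [Measure.volumeIoiPow, lintegral_withDensity_eq_lintegral_mul _ (by fun_prop) hσ]
  exact lintegral_subtype_comap measurableSet_Ioi
    (fun r : ℝ => ENNReal.ofReal (r ^ (n - 1)) * f (r • (σ : En n)))

section fin
variable {n : ℕ} {p lam : ℝ} {u : ℝ → En n → ℂ}

lemma NLSSolution.main (h : NLSSolution n p lam u) (hp : 1 < p) (hl : 0 < lam) (hn : 0 < n) :
    ∫⁻ t, ∫⁻ ξ, ‖‖ξ‖ ^ (-((n : ℝ) - 3)) * FF u t ξ‖ₑ ≤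
      ENNReal.ofReal (1 / (2 * Real.pi ^ 2)) *
        (ENNReal.ofReal (2 * MM u) * (volume : Measure (En n)).toSphere Set.univ) := by
  have hF := h.FF_meas
  have mg : Measurable fun q : (ℝ × Metric.sphere (0 : En n) 1) × ℝ =>
      ENNReal.ofReal (gi u (q.1.2 : En n) 0 q.1.1 q.2) := by
    have hc : Continuous fun q : (ℝ × Metric.sphere (0 : En n) 1) × ℝ =>
      (q.1.1, q.2 • (q.1.2 : En n)) := by fun_prop
    have hm := hc.measurable
    have h2 : Measurable fun q : (ℝ × Metric.sphere (0 : En n) 1) × ℝ =>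
        FF u q.1.1 (q.2 • (q.1.2 : En n)) := by
      generalize FF u = F at hF ⊢
      exact hF.comp hm
    unfold gi
    fun_prop
  have mA : Measurable fun q : ℝ × Metric.sphere (0 : En n) 1 =>
      ∫⁻ r, ENNReal.ofReal (gi u (q.2 : En n) 0 q.1 r) := mg.lintegral_prod_right'
  have s1 : ∀ t, ∫⁻ ξ, ‖‖ξ‖ ^ (-((n : ℝ) - 3)) * FF u t ξ‖ₑ ≤
      ENNReal.ofReal (1 / (2 * Real.pi ^ 2)) * ∫⁻ σ : Metric.sphere (0 : En n) 1,
        (∫⁻ r, ENNReal.ofReal (gi u (σ : En n) 0 t r)) ∂(volume : Measure (En n)).toSphere := by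
    intro t
    have mf : Measurable fun ξ : En n => ‖‖ξ‖ ^ (-((n : ℝ) - 3)) * FF u t ξ‖ₑ := by
      have hm : Measurable fun ξ : En n => (t, ξ) := by fun_prop
      have h2 : Measurable fun ξ : En n => FF u t ξ := by
        generalize FF u = F at hF ⊢
        exact hF.comp hm
      exact ((measurable_norm.pow_const _).mul h2).enorm
    rw [lintegral_polar hn mf, ← lintegral_const_mul' _ _ ENNReal.ofReal_ne_top]
    refine lintegral_mono fun σ => ?_
    rw [← lintegral_const_mul' _ _ ENNReal.ofReal_ne_top]
    refine le_trans (setLIntegral_mono' measurableSet_Ioi fun r hr => ?_)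
      (setLIntegral_le_lintegral (Set.Ioi (0:ℝ)) _)
    have hr0 : (0:ℝ) < r := hr
    have hnr : ‖r • (σ : En n)‖ = r := by
      rw [norm_smul, Real.norm_of_nonneg hr0.le, norm_eq_of_mem_sphere, mul_one]
    have hFn : 0 ≤ FF u t (r • (σ : En n)) := by unfold FF; positivity
    rw [hnr, Real.enorm_of_nonneg (by positivity), ← ENNReal.ofReal_mul (by positivity),
      ← ENNReal.ofReal_mul (by positivity)]
    refine le_of_eq (congrArg _ ?_)
    unfold gi
    have e : r ^ (n - 1) * r ^ (-((n : ℝ) - 3)) = r ^ 2 := by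
      rw [← Real.rpow_natCast, ← Real.rpow_add hr0, ← Real.rpow_natCast]
      congr 1
      rw [Nat.cast_sub hn]
      push_cast; ring
    rw [← mul_assoc, e]
    have : Real.pi ≠ 0 := Real.pi_ne_zero
    simp only [mul_zero, neg_zero, zero_mul, Real.exp_zero, one_mul]
    field_simp
  refine (lintegral_mono s1).trans ?_
  rw [lintegral_const_mul' _ _ ENNReal.ofReal_ne_top]
  gcongr
  rw [lintegral_lintegral_swap mA.aemeasurable]
  rw [← lintegral_const]
  refine lintegral_mono fun σ => h.time_int3 hp hl _ ?_
  rw [real_inner_self_eq_norm_sq, norm_eq_of_mem_sphere]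
  norm_num

end fin

/-- A priori global spacetime bound, defocusing case, `n ≥ 2`. -/
theorem statement_10 (n : ℕ) (hn : 2 ≤ n) :
    ∃ C : ℝ, 0 < C ∧
      ∀ (p lam : ℝ), 1 < p → 0 < lam →
        ∀ u : ℝ → En n → ℂ, NLSSolution n p lam u →
          Real.sqrt (∫ t : ℝ, ∫ ξ : En n,
              ‖ξ‖ ^ (-((n : ℝ) - 3)) * ‖𝓕 (fun x : En n => ((‖u t x‖ ^ 2 : ℝ) : ℂ)) ξ‖ ^ 2)
            ≤ C * (Real.sqrt (∫ x : En n, ‖u 0 x‖ ^ 2)) ^ ((3 : ℝ) / 2)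
                * (⨆ t : ℝ, Real.sqrt (∫ x : En n, ∑ j, ‖pd j (u t) x‖ ^ 2)) ^ ((1 : ℝ) / 2) := by
  set K : ℝ := 1 / (2 * Real.pi ^ 2) * (2 * ((volume : Measure (En n)).toSphere Set.univ).toReal) with hK
  have hK0 : 0 ≤ K := by positivity
  refine ⟨Real.sqrt K + 1, by positivity, ?_⟩
  intro p lam hp hl u h
  have hmain := h.main hp hl (by omega)
  have hS0 : 0 ≤ ⨆ t : ℝ, Real.sqrt (∫ x : En n, ∑ j, ‖pd j (u t) x‖ ^ 2) :=
    Real.iSup_nonneg fun t => Real.sqrt_nonneg _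
  have hM : MM u = (Real.sqrt (∫ x, ‖u 0 x‖ ^ 2)) ^ 3 *
      ⨆ t : ℝ, Real.sqrt (∫ x : En n, ∑ j, ‖pd j (u t) x‖ ^ 2) := rfl
  generalize (⨆ t : ℝ, Real.sqrt (∫ x : En n, ∑ j, ‖pd j (u t) x‖ ^ 2)) = S at *
  have hm0 : 0 ≤ Real.sqrt (∫ x : En n, ‖u 0 x‖ ^ 2) := Real.sqrt_nonneg _
  generalize Real.sqrt (∫ x : En n, ‖u 0 x‖ ^ 2) = m at *
  have hMM : 0 ≤ MM u := by rw [hM]; positivity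
  have b1 : (∫ t : ℝ, ∫ ξ : En n, ‖ξ‖ ^ (-((n : ℝ) - 3)) * FF u t ξ) ≤ K * MM u := by
    have h1 : ‖∫ t : ℝ, ∫ ξ : En n, ‖ξ‖ ^ (-((n : ℝ) - 3)) * FF u t ξ‖ₑ ≤ ENNReal.ofReal (K * MM u) := by
      refine (enorm_integral_le_lintegral_enorm _).trans ?_
      refine (lintegral_mono fun t => enorm_integral_le_lintegral_enorm _).trans ?_
      refine hmain.trans (le_of_eq ?_)
      rw [← ENNReal.ofReal_toReal (measure_ne_top (volume : Measure (En n)).toSphere Set.univ),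
        ← ENNReal.ofReal_mul (by positivity), ← ENNReal.ofReal_mul (by positivity), hK]
      congr 1
      ring
    rw [← ofReal_norm, ENNReal.ofReal_le_ofReal_iff (by positivity)] at h1
    exact (le_abs_self _).trans h1
  refine (Real.sqrt_le_sqrt b1).trans ?_
  clear_value K
  rw [hM, Real.sqrt_mul hK0, Real.sqrt_mul (by positivity)]
  have e1 : Real.sqrt (m ^ 3) = m ^ ((3:ℝ) / 2) := by
    rw [Real.sqrt_eq_rpow, ← Real.rpow_natCast, ← Real.rpow_mul hm0]
    norm_num
  rw [e1, Real.sqrt_eq_rpow S, mul_assoc]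
  have : 0 ≤ m ^ ((3:ℝ) / 2) * S ^ ((1:ℝ) / 2) := by positivity
  nlinarith
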